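/- arXiv:1812.08809 — 2 statements merged into one kernel-verified Lean document; each statement's English description precedes it below -/
import Mathlib

section
/- Let T be a strong semicomplete digraph on t ≥ 2 vertices and let H_1, ..., H_t be arbitrary digraphs, each with at least two vertices. Then Q = T[H_1, ..., H_t] has a pair of arc-disjoint strong spanning subdigraphs if and only if Q is not isomorphic to any of C3[K2bar, K2bar, K2bar], C3[P2, K2bar, K2bar], or C3[K2bar, K2bar, K3bar]. -/
/-- A digraph (given by its arc relation) is strong (strongly connected). -/
def IsStrong {V : Type*} (A : V → V → Prop) : Prop :=
  ∀ x y : V, Relation.ReflTransGen A x y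

/-- `A` has a pair of arc-disjoint strong spanning subdigraphs (a good decomposition). -/
def GoodDecomp {V : Type*} (A : V → V → Prop) : Prop :=
  ∃ A₁ A₂ : V → V → Prop,
    (∀ x y, A₁ x y → A x y) ∧ (∀ x y, A₂ x y → A x y) ∧
    (∀ x y, ¬ (A₁ x y ∧ A₂ x y)) ∧ IsStrong A₁ ∧ IsStrong A₂

/-- Arc relation of the composition `T[H_1, ..., H_t]`. -/
def CompArc {t : ℕ} {Vt : Fin t → Type*} (T : Fin t → Fin t → Prop)
    (H : ∀ i, Vt i → Vt i → Prop) : (Σ i, Vt i) → (Σ i, Vt i) → Prop :=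
  fun a b => T a.1 b.1 ∨ ∃ h : a.1 = b.1, H b.1 (h ▸ a.2) b.2


/-- The cyclic successor on `Fin n`. -/
def finSucc {n : ℕ} (x : Fin n) : Fin n := ⟨(x.val + 1) % n, Nat.mod_lt _ x.pos⟩

def Semicomplete {V : Type*} (A : V → V → Prop) : Prop :=
  ∀ x y : V, x ≠ y → A x y ∨ A y x

/-- `A` is 2-arc-strong: it stays strong after deleting any set of at most one arc. -/
def TwoArcStrong {V : Type*} (A : V → V → Prop) : Prop :=
  ∀ X : Set (V × V), X.Subsingleton → IsStrong (fun x y => A x y ∧ (x, y) ∉ X)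

/-- Digraph isomorphism. -/
def DIso {V W : Type*} (A : V → V → Prop) (B : W → W → Prop) : Prop :=
  ∃ e : V ≃ W, ∀ x y, A x y ↔ B (e x) (e y)

/-- Arc relation of the directed cycle on `n` vertices. -/
def CycleArc (n : ℕ) : Fin n → Fin n → Prop := fun x y => y = finSucc x

/-- `T` (on `Fin t`) has a Hamiltonian cycle. -/
def HasHamCycle {t : ℕ} (T : Fin t → Fin t → Prop) : Prop :=
  ∃ e : Equiv.Perm (Fin t), ∀ i, T (e i) (e (finSucc i))

/-- Cartesian product of digraphs. -/
def CartProd {V W : Type*} (A : V → V → Prop) (B : W → W → Prop) :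
    V × W → V × W → Prop :=
  fun p q => (A p.1 q.1 ∧ p.2 = q.2) ∨ (p.1 = q.1 ∧ B p.2 q.2)

/-- Strong product of digraphs. -/
def StrongProd {V W : Type*} (A : V → V → Prop) (B : W → W → Prop) :
    V × W → V × W → Prop :=
  fun p q => (A p.1 q.1 ∧ p.2 = q.2) ∨ (p.1 = q.1 ∧ B p.2 q.2) ∨ (A p.1 q.1 ∧ B p.2 q.2)

/-- Lexicographic product of digraphs. -/
def LexProd {V W : Type*} (A : V → V → Prop) (B : W → W → Prop) :
    V × W → V × W → Prop :=
  fun p q => A p.1 q.1 ∨ (p.1 = q.1 ∧ B p.2 q.2)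

/-- `k`-th Cartesian power of a digraph. -/
def CartPow {V : Type*} (A : V → V → Prop) (k : ℕ) :
    (Fin k → V) → (Fin k → V) → Prop :=
  fun f g => ∃ i, A (f i) (g i) ∧ ∀ j, j ≠ i → f j = g j

/-- `A` has a collection of pairwise arc-disjoint directed cycles covering all vertices. -/
def HasCycleCover {V : Type*} (A : V → V → Prop) : Prop :=
  ∃ (k : ℕ) (m : Fin k → ℕ) (c : ∀ i : Fin k, Fin (m i) → V),
    (∀ i, 2 ≤ m i) ∧ (∀ i, Function.Injective (c i)) ∧
    (∀ i x, A (c i x) (c i (finSucc x))) ∧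
    (∀ i j x y, c i x = c j y → c i (finSucc x) = c j (finSucc y) → i = j) ∧
    (∀ v : V, ∃ i x, c i x = v)

/-- The digraph `C3[K2bar, K2bar, K2bar]`. -/
def Exc1 : Fin 3 × Fin 2 → Fin 3 × Fin 2 → Prop := fun p q => q.1 = finSucc p.1

/-- The digraph `C3[P2, K2bar, K2bar]`, the single arc of `P2` being `(0,0) → (0,1)`. -/
def Exc2 : Fin 3 × Fin 2 → Fin 3 × Fin 2 → Prop :=
  fun p q => q.1 = finSucc p.1 ∨ (p.1 = 0 ∧ q.1 = 0 ∧ p.2 = 0 ∧ q.2 = 1)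

/-- Block index for `C3[K2bar, K2bar, K3bar]`. -/
def blk : (Fin 2 ⊕ Fin 2 ⊕ Fin 3) → Fin 3 :=
  Sum.elim (fun _ => 0) (Sum.elim (fun _ => 1) (fun _ => 2))

/-- The digraph `C3[K2bar, K2bar, K3bar]`. -/
def Exc3 : (Fin 2 ⊕ Fin 2 ⊕ Fin 3) → (Fin 2 ⊕ Fin 2 ⊕ Fin 3) → Prop :=
  fun p q => blk q = finSucc (blk p)

/-- `S4`: the complete digraph on 4 vertices minus the directed 4-cycle `x → x+1`. -/
def S4Arc : Fin 4 → Fin 4 → Prop := fun x y => x ≠ y ∧ y ≠ finSucc x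

/-- `B` connects any two vertices of `S`. -/
def StrongOn {V : Type*} (B : V → V → Prop) (S : Set V) : Prop :=
  ∀ x ∈ S, ∀ y ∈ S, Relation.ReflTransGen B x y

/-- The subdigraph of `A` induced by `S` has a good decomposition. -/
def GoodOn {V : Type*} (A : V → V → Prop) (S : Set V) : Prop :=
  ∃ B₁ B₂ : V → V → Prop,
    (∀ x y, B₁ x y → A x y ∧ x ∈ S ∧ y ∈ S) ∧ (∀ x y, B₂ x y → A x y ∧ x ∈ S ∧ y ∈ S) ∧
    (∀ x y, ¬ (B₁ x y ∧ B₂ x y)) ∧ StrongOn B₁ S ∧ StrongOn B₂ S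

theorem GoodOn.goodDecomp {V : Type*} {A : V → V → Prop} {S : Set V} (h : GoodOn A S)
    (hS : ∀ x, x ∈ S) : GoodDecomp A := by
  obtain ⟨B₁, B₂, h₁, h₂, hd, s₁, s₂⟩ := h
  exact ⟨B₁, B₂, fun x y h => (h₁ x y h).1, fun x y h => (h₂ x y h).1, hd,
    fun x y => s₁ x (hS x) y (hS y), fun x y => s₂ x (hS x) y (hS y)⟩

theorem IsStrong.exists_arc_leaving {V : Type*} {B : V → V → Prop} (h : IsStrong B) (S : V → Prop)
    (hS : ∃ v, S v) (hS' : ∃ v, ¬ S v) : ∃ u v, S u ∧ ¬ S v ∧ B u v := by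
  obtain ⟨x, hx⟩ := hS
  obtain ⟨y, hy⟩ := hS'
  by_contra! hc
  have key : ∀ z, Relation.ReflTransGen B x z → S z := by
    intro z hz
    induction hz with
    | refl => exact hx
    | tail _ hb ih =>
      by_contra hn
      exact hc _ _ ih hn hb
  exact hy (key y (h x y))

theorem StrongOn.extend {V : Type*} {B C : V → V → Prop} {S S' : Set V} (hC : StrongOn C S)
    (hB : ∀ v ∈ S', v ∉ S →
      (∃ s ∈ S, Relation.ReflTransGen B s v) ∧ ∃ s ∈ S, Relation.ReflTransGen B v s) :
    StrongOn (fun x y => C x y ∨ B x y) S' := by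
  have hB' : ∀ v ∈ S', (∃ s ∈ S, Relation.ReflTransGen B s v) ∧
      ∃ s ∈ S, Relation.ReflTransGen B v s := by
    intro v hv
    by_cases h : v ∈ S
    · exact ⟨⟨v, h, .refl⟩, ⟨v, h, .refl⟩⟩
    · exact hB v hv h
  intro x hx y hy
  obtain ⟨-, s, hs, h₁⟩ := hB' x hx
  obtain ⟨⟨s', hs', h₂⟩, -⟩ := hB' y hy
  exact ((Relation.ReflTransGen.mono (fun _ _ => Or.inr) _ _ h₁).trans
    (Relation.ReflTransGen.mono (fun _ _ => Or.inl) _ _ (hC s hs s' hs'))).trans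
    (Relation.ReflTransGen.mono (fun _ _ => Or.inr) _ _ h₂)

theorem GoodOn.extend {V : Type*} {A : V → V → Prop} {S S' : Set V} (h : GoodOn A S)
    (hSS : S ⊆ S') (B₁ B₂ : V → V → Prop)
    (h₁ : ∀ x y, B₁ x y → A x y ∧ x ∈ S' ∧ y ∈ S' ∧ (x ∉ S ∨ y ∉ S))
    (h₂ : ∀ x y, B₂ x y → A x y ∧ x ∈ S' ∧ y ∈ S' ∧ (x ∉ S ∨ y ∉ S))
    (hd : ∀ x y, ¬ (B₁ x y ∧ B₂ x y))
    (s₁ : ∀ v ∈ S', v ∉ S →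
      (∃ s ∈ S, Relation.ReflTransGen B₁ s v) ∧ ∃ s ∈ S, Relation.ReflTransGen B₁ v s)
    (s₂ : ∀ v ∈ S', v ∉ S →
      (∃ s ∈ S, Relation.ReflTransGen B₂ s v) ∧ ∃ s ∈ S, Relation.ReflTransGen B₂ v s) :
    GoodOn A S' := by
  obtain ⟨C₁, C₂, c₁, c₂, cd, t₁, t₂⟩ := h
  refine ⟨fun x y => C₁ x y ∨ B₁ x y, fun x y => C₂ x y ∨ B₂ x y, ?_, ?_, ?_,
    t₁.extend s₁, t₂.extend s₂⟩
  · rintro x y (h | h)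
    · exact ⟨(c₁ x y h).1, hSS (c₁ x y h).2.1, hSS (c₁ x y h).2.2⟩
    · exact ⟨(h₁ x y h).1, (h₁ x y h).2.1, (h₁ x y h).2.2.1⟩
  · rintro x y (h | h)
    · exact ⟨(c₂ x y h).1, hSS (c₂ x y h).2.1, hSS (c₂ x y h).2.2⟩
    · exact ⟨(h₂ x y h).1, (h₂ x y h).2.1, (h₂ x y h).2.2.1⟩
  · rintro x y ⟨h | h, h' | h'⟩
    · exact cd x y ⟨h, h'⟩
    · have := c₁ x y h; have := h₂ x y h'; tauto
    · have := h₁ x y h; have := c₂ x y h'; tauto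
    · exact hd x y ⟨h, h'⟩

theorem GoodOn.extend_of_two_neighbors {V : Type*} {A : V → V → Prop} {S S' : Set V}
    (h : GoodOn A S) (hSS : S ⊆ S')
    (hin : ∀ v ∈ S', v ∉ S → ∃ p ∈ S, ∃ q ∈ S, p ≠ q ∧ A p v ∧ A q v)
    (hout : ∀ v ∈ S', v ∉ S → ∃ p ∈ S, ∃ q ∈ S, p ≠ q ∧ A v p ∧ A v q) : GoodOn A S' := by
  rcases isEmpty_or_nonempty V with hV | hV
  · exact ⟨A, A, fun x => isEmptyElim x, fun x => isEmptyElim x, fun x => isEmptyElim x,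
      fun x => isEmptyElim x, fun x => isEmptyElim x⟩
  choose! p hp q hq hpq hpA hqA using hin
  choose! r hr s hs hrs hrA hsA using hout
  refine h.extend hSS (fun x y => (y ∈ S' ∧ y ∉ S ∧ x = p y) ∨ (x ∈ S' ∧ x ∉ S ∧ y = r x))
    (fun x y => (y ∈ S' ∧ y ∉ S ∧ x = q y) ∨ (x ∈ S' ∧ x ∉ S ∧ y = s x)) ?_ ?_ ?_ ?_ ?_
  · rintro x y (⟨h1, h2, rfl⟩ | ⟨h1, h2, rfl⟩)
    · exact ⟨hpA _ h1 h2, hSS (hp _ h1 h2), h1, Or.inr h2⟩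
    · exact ⟨hrA _ h1 h2, h1, hSS (hr _ h1 h2), Or.inl h2⟩
  · rintro x y (⟨h1, h2, rfl⟩ | ⟨h1, h2, rfl⟩)
    · exact ⟨hqA _ h1 h2, hSS (hq _ h1 h2), h1, Or.inr h2⟩
    · exact ⟨hsA _ h1 h2, h1, hSS (hs _ h1 h2), Or.inl h2⟩
  · rintro x y ⟨⟨h1, h2, h3⟩ | ⟨h1, h2, h3⟩, ⟨h4, h5, h6⟩ | ⟨h4, h5, h6⟩⟩
    · exact hpq _ h1 h2 (h3.symm.trans h6)
    · exact h5 (h3 ▸ hp _ h1 h2)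
    · exact h2 (h6 ▸ hq _ h4 h5)
    · exact hrs _ h1 h2 (h3.symm.trans h6)
  · exact fun v hv hv' => ⟨⟨p v, hp v hv hv', .single (Or.inl ⟨hv, hv', rfl⟩)⟩,
      ⟨r v, hr v hv hv', .single (Or.inr ⟨hv, hv', rfl⟩)⟩⟩
  · exact fun v hv hv' => ⟨⟨q v, hq v hv hv', .single (Or.inl ⟨hv, hv', rfl⟩)⟩,
      ⟨s v, hs v hv hv', .single (Or.inr ⟨hv, hv', rfl⟩)⟩⟩

/-- `S` contains at least two vertices of the fibre of `π` over `i`. -/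
def TwoInFiber {V I : Type*} (π : V → I) (S : Set V) (i : I) : Prop :=
  ∃ p ∈ S, ∃ q ∈ S, p ≠ q ∧ π p = i ∧ π q = i

theorem GoodOn.fill {V I : Type*} {A : V → V → Prop} {T : I → I → Prop} {π : V → I}
    (hA : ∀ u v, T (π u) (π v) → A u v) {S : Set V} {U : Set I} (h : GoodOn A S)
    (hSU : S ⊆ π ⁻¹' U) (hin : ∀ i ∈ U, ∃ j, T j i ∧ TwoInFiber π S j)
    (hout : ∀ i ∈ U, ∃ j, T i j ∧ TwoInFiber π S j) : GoodOn A (π ⁻¹' U) := by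
  refine h.extend_of_two_neighbors hSU ?_ ?_
  · intro v hv _
    obtain ⟨j, hj, p, hp, q, hq, hpq, rfl, hq'⟩ := hin _ hv
    exact ⟨p, hp, q, hq, hpq, hA _ _ hj, hA _ _ (hq' ▸ hj)⟩
  · intro v hv _
    obtain ⟨j, hj, p, hp, q, hq, hpq, rfl, hq'⟩ := hout _ hv
    exact ⟨p, hp, q, hq, hpq, hA _ _ hj, hA _ _ (hq' ▸ hj)⟩

theorem GoodOn.insert_vertex {V I : Type*} {A : V → V → Prop} {T : I → I → Prop} {π : V → I}
    (hA : ∀ u v, T (π u) (π v) → A u v) (h2 : ∀ i, ∃ p q, p ≠ q ∧ π p = i ∧ π q = i)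
    {U : Set I} (h : GoodOn A (π ⁻¹' U)) {c d u : I} (hc : c ∈ U) (hd : d ∈ U)
    (hcu : T c u) (hud : T u d) : GoodOn A (π ⁻¹' (insert u U)) := by
  have two : ∀ i ∈ U, TwoInFiber π (π ⁻¹' U) i := by
    intro i hi
    obtain ⟨p, q, hpq, rfl, hq⟩ := h2 i
    exact ⟨p, hi, q, by simpa [hq] using hi, hpq, rfl, hq⟩
  refine h.extend_of_two_neighbors (Set.preimage_mono (Set.subset_insert u U)) ?_ ?_
  · intro v hv hv'
    have hv'' : π v = u := by simpa [show π v ∉ U from hv'] using hv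
    obtain ⟨p, hp, q, hq, hpq, h3, h4⟩ := two c hc
    exact ⟨p, hp, q, hq, hpq, hA _ _ (by rwa [h3, hv'']), hA _ _ (by rwa [h4, hv''])⟩
  · intro v hv hv'
    have hv'' : π v = u := by simpa [show π v ∉ U from hv'] using hv
    obtain ⟨p, hp, q, hq, hpq, h3, h4⟩ := two d hd
    exact ⟨p, hp, q, hq, hpq, hA _ _ (by rwa [h3, hv'']), hA _ _ (by rwa [h4, hv''])⟩

theorem reflTransGen_of_two_paths {V : Type*} {B : V → V → Prop} {S : Set V}
    {c d a a' b b' : V} (hc : c ∈ S) (hd : d ∈ S) (hca : B c a) (hca' : B c a') (hab : B a b)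
    (hab' : B a' b') (hbd : B b d) (hbd' : B b' d) {v : V}
    (hv : v = a ∨ v = a' ∨ v = b ∨ v = b') :
    (∃ s ∈ S, Relation.ReflTransGen B s v) ∧ ∃ s ∈ S, Relation.ReflTransGen B v s := by
  refine ⟨⟨c, hc, ?_⟩, ⟨d, hd, ?_⟩⟩ <;> rcases hv with rfl | rfl | rfl | rfl
  exacts [.single hca, .single hca', (Relation.ReflTransGen.single hca).tail hab,
    (Relation.ReflTransGen.single hca').tail hab', (Relation.ReflTransGen.single hab).tail hbd,
    (Relation.ReflTransGen.single hab').tail hbd', .single hbd, .single hbd']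

theorem GoodOn.insert_pair {V I : Type*} {A : V → V → Prop} {T : I → I → Prop} {π : V → I}
    (hA : ∀ u v, T (π u) (π v) → A u v) (h2 : ∀ i, ∃ p q, p ≠ q ∧ π p = i ∧ π q = i)
    {U : Set I} (h : GoodOn A (π ⁻¹' U)) {c d u w : I} (hc : c ∈ U) (hd : d ∈ U)
    (hu : u ∉ U) (hw : w ∉ U) (huw' : u ≠ w)
    (hcu : T c u) (huw : T u w) (hwd : T w d) : GoodOn A (π ⁻¹' (insert u (insert w U))) := by
  obtain ⟨c₀, c₁, hc', rfl, hc₁⟩ := h2 c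
  obtain ⟨d₀, d₁, hd', rfl, hd₁⟩ := h2 d
  obtain ⟨u₀, u₁, hu', rfl, hu₁⟩ := h2 u
  obtain ⟨w₀, w₁, hw', rfl, hw₁⟩ := h2 w
  have hc₁U : π c₁ ∈ U := hc₁ ▸ hc
  have hd₁U : π d₁ ∈ U := hd₁ ▸ hd
  have hu₁U : π u₁ ∉ U := hu₁ ▸ hu
  have hw₁U : π w₁ ∉ U := hw₁ ▸ hw
  have key : GoodOn A (π ⁻¹' U ∪ {u₀, u₁, w₀, w₁}) := by
    refine h.extend Set.subset_union_left
      (fun x y => (x = c₀ ∧ y = u₀) ∨ (x = c₀ ∧ y = u₁) ∨ (x = u₀ ∧ y = w₀) ∨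
        (x = u₁ ∧ y = w₁) ∨ (x = w₀ ∧ y = d₀) ∨ (x = w₁ ∧ y = d₀))
      (fun x y => (x = c₁ ∧ y = u₀) ∨ (x = c₁ ∧ y = u₁) ∨ (x = u₀ ∧ y = w₁) ∨
        (x = u₁ ∧ y = w₀) ∨ (x = w₀ ∧ y = d₁) ∨ (x = w₁ ∧ y = d₁)) ?_ ?_ ?_ ?_ ?_
    · rintro x y (⟨rfl, rfl⟩ | ⟨rfl, rfl⟩ | ⟨rfl, rfl⟩ | ⟨rfl, rfl⟩ | ⟨rfl, rfl⟩ | ⟨rfl, rfl⟩) <;>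
        refine ⟨hA _ _ (by simp [*]), ?_⟩ <;> simp [*]
    · rintro x y (⟨rfl, rfl⟩ | ⟨rfl, rfl⟩ | ⟨rfl, rfl⟩ | ⟨rfl, rfl⟩ | ⟨rfl, rfl⟩ | ⟨rfl, rfl⟩) <;>
        refine ⟨hA _ _ (by simp [*]), ?_⟩ <;> simp [*]
    · grind
    · intro v hv hv'
      refine reflTransGen_of_two_paths (c := c₀) (d := d₀) (a := u₀) (a' := u₁) (b := w₀)
        (b' := w₁) hc hd ?_ ?_ ?_ ?_ ?_ ?_ (hv.resolve_left hv') <;> simp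
    · intro v hv hv'
      refine reflTransGen_of_two_paths (c := c₁) (d := d₁) (a := u₀) (a' := u₁) (b := w₁)
        (b' := w₀) hc₁U hd₁U ?_ ?_ ?_ ?_ ?_ ?_
        ((hv.resolve_left hv').imp_right (Or.imp_right Or.symm)) <;> simp
  have two : ∀ i, i = π u₀ ∨ i = π w₀ ∨ i ∈ U →
      TwoInFiber π (π ⁻¹' U ∪ {u₀, u₁, w₀, w₁}) i := by
    rintro i (rfl | rfl | hi)
    · exact ⟨u₀, by simp, u₁, by simp, hu', rfl, hu₁⟩
    · exact ⟨w₀, by simp, w₁, by simp, hw', rfl, hw₁⟩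
    · obtain ⟨p, q, hpq, rfl, hq⟩ := h2 i
      exact ⟨p, Or.inl hi, q, Or.inl (by simpa [hq] using hi), hpq, rfl, hq⟩
  refine key.extend_of_two_neighbors ?_ ?_ ?_
  · rintro x (hx | rfl | rfl | rfl | rfl)
    · exact Or.inr (Or.inr hx)
    all_goals simp [*]
  · rintro v (hv | hv | hv) hv'
    · obtain ⟨p, hp, q, hq, hpq, h3, h4⟩ := two (π c₀) (Or.inr (Or.inr hc))
      exact ⟨p, hp, q, hq, hpq, hA _ _ (by rwa [h3, hv]), hA _ _ (by rwa [h4, hv])⟩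
    · obtain ⟨p, hp, q, hq, hpq, h3, h4⟩ := two (π u₀) (Or.inl rfl)
      exact ⟨p, hp, q, hq, hpq, hA _ _ (by rwa [h3, hv]), hA _ _ (by rwa [h4, hv])⟩
    · exact absurd (Or.inl hv) hv'
  · rintro v (hv | hv | hv) hv'
    · obtain ⟨p, hp, q, hq, hpq, h3, h4⟩ := two (π w₀) (Or.inr (Or.inl rfl))
      exact ⟨p, hp, q, hq, hpq, hA _ _ (by rwa [h3, hv]), hA _ _ (by rwa [h4, hv])⟩
    · obtain ⟨p, hp, q, hq, hpq, h3, h4⟩ := two (π d₀) (Or.inr (Or.inr hd))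
      exact ⟨p, hp, q, hq, hpq, hA _ _ (by rwa [h3, hv]), hA _ _ (by rwa [h4, hv])⟩
    · exact absurd (Or.inl hv) hv'

theorem goodDecomp_of_goodOn_preimage {V I : Type*} [Finite I] {A : V → V → Prop}
    {T : I → I → Prop} {π : V → I} (hA : ∀ u v, T (π u) (π v) → A u v)
    (h2 : ∀ i, ∃ p q, p ≠ q ∧ π p = i ∧ π q = i) (hTs : IsStrong T) (hTsc : Semicomplete T)
    {U₀ : Set I} (hne : U₀.Nonempty) (h : GoodOn A (π ⁻¹' U₀)) : GoodDecomp A := by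
  obtain ⟨U, ⟨hU, hne⟩, hmax⟩ := (Set.toFinite
    {U : Set I | GoodOn A (π ⁻¹' U) ∧ U.Nonempty}).exists_maximal ⟨U₀, h, hne⟩
  have hmax' : ∀ u s, GoodOn A (π ⁻¹' (insert u s)) → U ⊆ s → u ∈ U := fun u s hs hUs =>
    hmax ⟨hs, Set.insert_nonempty u s⟩ (hUs.trans (Set.subset_insert u s)) (Set.mem_insert u s)
  refine hU.goodDecomp fun x => ?_
  by_contra hx
  have no : ∀ c ∈ U, ∀ d ∈ U, ∀ u ∉ U, T c u → ¬ T u d := fun c hc d hd u hu hcu hud =>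
    hu (hmax' u U (hU.insert_vertex hA h2 hc hd hcu hud) subset_rfl)
  obtain ⟨c, u, hc, hu, hcu⟩ := hTs.exists_arc_leaving (· ∈ U) hne ⟨_, hx⟩
  obtain ⟨u, w, ⟨hu, c, hc, hcu⟩, hw, huw⟩ := hTs.exists_arc_leaving
    (fun i => i ∉ U ∧ ∃ c ∈ U, T c i) ⟨u, hu, c, hc, hcu⟩ ⟨c, fun h => h.1 hc⟩
  have hwU : w ∉ U := fun hwU => no c hc w hwU u hu hcu huw
  have hcw : ¬ T c w := fun h => hw ⟨hwU, c, hc, h⟩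
  have hwc : T w c := (hTsc w c (by rintro rfl; exact hwU hc)).resolve_right hcw
  refine hu (hmax' u (insert w U) (hU.insert_pair hA h2 hc hc hu hwU ?_ hcu huw hwc)
    (Set.subset_insert w U))
  rintro rfl
  exact hcw hcu

theorem strongOn_range_of_walk {V W : Type*} {p : ℕ} (f : W → V) (w : Fin p → W) :
    StrongOn (fun u v => ∃ i, u = f (w i) ∧ v = f (w (finSucc i))) (Set.range (f ∘ w)) := by
  rintro _ ⟨i, rfl⟩ _ ⟨j, rfl⟩
  have key : ∀ m, Relation.ReflTransGen
      (fun u v => ∃ i, u = f (w i) ∧ v = f (w (finSucc i))) (f (w i))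
      (f (w ⟨(i + m) % p, Nat.mod_lt _ i.pos⟩)) := by
    intro m
    induction m with
    | zero => simpa [Nat.mod_eq_of_lt i.isLt] using Relation.ReflTransGen.refl
    | succ m ih => exact ih.tail ⟨_, rfl, by simp [finSucc, add_assoc]⟩
  have h := key (p - i + j)
  have e : (i + (p - i + j)) % p = (j : ℕ) := by
    have := i.isLt
    rw [show (i : ℕ) + (p - i + j) = j + p by omega, Nat.add_mod_right, Nat.mod_eq_of_lt j.isLt]
  simpa [e] using h

/-- Two arc-disjoint spanning closed walks of a digraph `W` mapped injectively into `A`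
give a good decomposition. -/
theorem goodOn_of_walks {V W : Type*} {A : V → V → Prop} {p q : ℕ} {f : W → V}
    (hf : f.Injective) (w₁ : Fin p → W) (w₂ : Fin q → W) (s₁ : w₁.Surjective) (s₂ : w₂.Surjective)
    (h₁ : ∀ i, A (f (w₁ i)) (f (w₁ (finSucc i)))) (h₂ : ∀ i, A (f (w₂ i)) (f (w₂ (finSucc i))))
    (hd : ∀ i j, w₁ i = w₂ j → w₁ (finSucc i) ≠ w₂ (finSucc j)) : GoodOn A (Set.range f) := by
  refine ⟨fun u v => ∃ i, u = f (w₁ i) ∧ v = f (w₁ (finSucc i)),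
    fun u v => ∃ i, u = f (w₂ i) ∧ v = f (w₂ (finSucc i)), ?_, ?_, ?_, ?_, ?_⟩
  · rintro _ _ ⟨i, rfl, rfl⟩
    exact ⟨h₁ i, ⟨_, rfl⟩, ⟨_, rfl⟩⟩
  · rintro _ _ ⟨i, rfl, rfl⟩
    exact ⟨h₂ i, ⟨_, rfl⟩, ⟨_, rfl⟩⟩
  · rintro u v ⟨⟨i, hi, hi'⟩, ⟨j, hj, hj'⟩⟩
    exact hd i j (hf (hi.symm.trans hj)) (hf (hi'.symm.trans hj'))
  · simpa [s₁.range_comp f] using strongOn_range_of_walk f w₁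
  · simpa [s₂.range_comp f] using strongOn_range_of_walk f w₂

theorem goodOn_preimage_range_of_walks {V I W : Type*} {A : V → V → Prop} {T : I → I → Prop}
    {π : V → I} (hA : ∀ u v, T (π u) (π v) → A u v) {k p q : ℕ} (β : W → Fin k)
    {f : W → V} (hf : f.Injective) (ι : Fin k → I) (hι : ∀ x, π (f x) = ι (β x))
    (hT : ∀ i, T (ι i) (ι (finSucc i))) (hβ : ∀ i, ∃ x y, x ≠ y ∧ β x = i ∧ β y = i)
    (hpred : ∀ i : Fin k, ∃ j, finSucc j = i)
    (E : W → W → Prop) (hE : ∀ x y, E x y → A (f x) (f y))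
    (w₁ : Fin p → W) (w₂ : Fin q → W) (s₁ : w₁.Surjective) (s₂ : w₂.Surjective)
    (h₁ : ∀ i, β (w₁ (finSucc i)) = finSucc (β (w₁ i)) ∨ E (w₁ i) (w₁ (finSucc i)))
    (h₂ : ∀ i, β (w₂ (finSucc i)) = finSucc (β (w₂ i)) ∨ E (w₂ i) (w₂ (finSucc i)))
    (hd : ∀ i j, w₁ i = w₂ j → w₁ (finSucc i) ≠ w₂ (finSucc j)) :
    GoodOn A (π ⁻¹' Set.range ι) := by
  have arc : ∀ x y, β y = finSucc (β x) ∨ E x y → A (f x) (f y) := by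
    rintro x y (h | h)
    · exact hA _ _ (by simpa [hι, h] using hT (β x))
    · exact hE x y h
  have two : ∀ i, TwoInFiber π (Set.range f) (ι i) := by
    intro i
    obtain ⟨x, y, hxy, rfl, hy⟩ := hβ i
    exact ⟨f x, ⟨x, rfl⟩, f y, ⟨y, rfl⟩, hf.ne hxy, hι x, by rw [hι, hy]⟩
  refine (goodOn_of_walks hf w₁ w₂ s₁ s₂ (fun i => arc _ _ (h₁ i)) (fun i => arc _ _ (h₂ i))
    hd).fill hA ?_ ?_ ?_
  · rintro _ ⟨x, rfl⟩
    exact ⟨β x, (hι x).symm⟩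
  · rintro _ ⟨i, rfl⟩
    obtain ⟨j, rfl⟩ := hpred i
    exact ⟨ι j, hT j, two j⟩
  · rintro _ ⟨i, rfl⟩
    exact ⟨ι (finSucc i), hT i, two _⟩

theorem goodOn_preimage_range_of_two_vertices {V I : Type*} {A : V → V → Prop} {T : I → I → Prop}
    {π : V → I} (hA : ∀ u v, T (π u) (π v) → A u v)
    (h2 : ∀ i, ∃ p q, p ≠ q ∧ π p = i ∧ π q = i) {k p q : ℕ} (ι : Fin k → I)
    (hι : ι.Injective) (hT : ∀ i, T (ι i) (ι (finSucc i)))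
    (hpred : ∀ i : Fin k, ∃ j, finSucc j = i)
    (w₁ : Fin p → Fin k × Fin 2) (w₂ : Fin q → Fin k × Fin 2)
    (s₁ : w₁.Surjective) (s₂ : w₂.Surjective)
    (h₁ : ∀ i, (w₁ (finSucc i)).1 = finSucc (w₁ i).1)
    (h₂ : ∀ i, (w₂ (finSucc i)).1 = finSucc (w₂ i).1)
    (hd : ∀ i j, w₁ i = w₂ j → w₁ (finSucc i) ≠ w₂ (finSucc j)) :
    GoodOn A (π ⁻¹' Set.range ι) := by
  choose g g' hgg' hg hg' using h2
  have hπ : ∀ x : Fin k × Fin 2, π (![g (ι x.1), g' (ι x.1)] x.2) = ι x.1 := by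
    rintro ⟨i, j⟩
    fin_cases j
    exacts [hg _, hg' _]
  refine goodOn_preimage_range_of_walks hA Prod.fst
    (f := fun x => ![g (ι x.1), g' (ι x.1)] x.2) ?_ ι hπ hT
    (fun i => ⟨(i, 0), (i, 1), by simp, rfl, rfl⟩) hpred (fun _ _ => False) (fun _ _ h => h.elim)
    w₁ w₂ s₁ s₂ (fun i => Or.inl (h₁ i)) (fun i => Or.inl (h₂ i)) hd
  intro x y hxy
  have h1 : x.1 = y.1 := hι (by rw [← hπ x, ← hπ y]; exact congrArg π hxy)
  obtain ⟨i, j⟩ := x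
  obtain ⟨i', j'⟩ := y
  obtain rfl : i = i' := h1
  have hne := hgg' (ι i)
  fin_cases j <;> fin_cases j'
  exacts [rfl, absurd hxy hne, absurd hxy.symm hne, rfl]

theorem goodOn_of_two_cycle {V I : Type*} {A : V → V → Prop} {T : I → I → Prop}
    {π : V → I} (hA : ∀ u v, T (π u) (π v) → A u v)
    (h2 : ∀ i, ∃ p q, p ≠ q ∧ π p = i ∧ π q = i) {a b : I} (hne : a ≠ b)
    (hab : T a b) (hba : T b a) : GoodOn A (π ⁻¹' Set.range ![a, b]) := by
  refine goodOn_preimage_range_of_two_vertices hA h2 ![a, b] ?_ ?_ (by decide)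
    ![(0, 0), (1, 0), (0, 1), (1, 1)] ![(0, 0), (1, 1), (0, 1), (1, 0)]
    (by decide) (by decide) (by decide) (by decide) (by decide)
  · simpa [Function.Injective, Fin.forall_fin_succ] using ⟨hne, hne.symm⟩
  · simpa [Fin.forall_fin_succ, finSucc] using ⟨hab, hba⟩

theorem goodOn_of_four_cycle {V I : Type*} {A : V → V → Prop} {T : I → I → Prop}
    {π : V → I} (hA : ∀ u v, T (π u) (π v) → A u v)
    (h2 : ∀ i, ∃ p q, p ≠ q ∧ π p = i ∧ π q = i) {a b c d : I}
    (hne : [a, b, c, d].Nodup)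
    (hab : T a b) (hbc : T b c) (hcd : T c d) (hda : T d a) :
    GoodOn A (π ⁻¹' Set.range ![a, b, c, d]) := by
  refine goodOn_preimage_range_of_two_vertices hA h2 ![a, b, c, d] ?_ ?_ (by decide)
    ![(0, 0), (1, 0), (2, 0), (3, 0), (0, 1), (1, 1), (2, 1), (3, 1)]
    ![(0, 0), (1, 1), (2, 0), (3, 1), (0, 1), (1, 0), (2, 1), (3, 0)]
    (by decide) (by decide) (by decide) (by decide) (by decide)
  · simp only [List.nodup_cons, List.mem_cons] at hne
    simp [Function.Injective, Fin.forall_fin_succ]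
    grind
  · simpa [Fin.forall_fin_succ, finSucc] using ⟨hab, hbc, hcd, hda⟩

/-- `A` is a composition of the directed 3-cycle `a → b → c → a`, with blocks the fibres
of `π`. -/
structure C3Comp {V I : Type*} (A : V → V → Prop) (π : V → I) (a b c : I) : Prop where
  ab : a ≠ b
  bc : b ≠ c
  ca : c ≠ a
  cover : ∀ i, i = a ∨ i = b ∨ i = c
  arc_ab : ∀ u v, π u = a → π v = b → A u v
  arc_bc : ∀ u v, π u = b → π v = c → A u v
  arc_ca : ∀ u v, π u = c → π v = a → A u v
  arc : ∀ u v, A u v → π u ≠ π v →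
    π u = a ∧ π v = b ∨ π u = b ∧ π v = c ∨ π u = c ∧ π v = a
  irrefl : ∀ u, ¬ A u u

theorem C3Comp.rotate {V I : Type*} {A : V → V → Prop} {π : V → I} {a b c : I}
    (h : C3Comp A π a b c) : C3Comp A π b c a where
  ab := h.bc
  bc := h.ca
  ca := h.ab
  cover i := by have := h.cover i; tauto
  arc_ab := h.arc_bc
  arc_bc := h.arc_ca
  arc_ca := h.arc_ab
  arc u v hA hne := by have := h.arc u v hA hne; tauto
  irrefl := h.irrefl

/-- The block of a vertex in a composition of the directed 3-cycle. -/
def block {l m n : ℕ} : Fin l ⊕ Fin m ⊕ Fin n → Fin 3 :=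
  Sum.elim (fun _ => 0) (Sum.elim (fun _ => 1) (fun _ => 2))

theorem C3Comp.goodDecomp_of_walks {V I : Type*} {A : V → V → Prop} {π : V → I} {a b c : I}
    (h : C3Comp A π a b c) {l m n p q : ℕ} {x : Fin l → V} {y : Fin m → V} {z : Fin n → V}
    (hx : x.Injective) (hy : y.Injective) (hz : z.Injective)
    (hxa : ∀ i, π (x i) = a) (hyb : ∀ i, π (y i) = b) (hzc : ∀ i, π (z i) = c)
    (hl : 2 ≤ l) (hm : 2 ≤ m) (hn : 2 ≤ n)
    (E : Fin l ⊕ Fin m ⊕ Fin n → Fin l ⊕ Fin m ⊕ Fin n → Prop)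
    (hE : ∀ u v, E u v → A (Sum.elim x (Sum.elim y z) u) (Sum.elim x (Sum.elim y z) v))
    (w₁ : Fin p → Fin l ⊕ Fin m ⊕ Fin n) (w₂ : Fin q → Fin l ⊕ Fin m ⊕ Fin n)
    (s₁ : w₁.Surjective) (s₂ : w₂.Surjective)
    (h₁ : ∀ i, block (w₁ (finSucc i)) = finSucc (block (w₁ i)) ∨ E (w₁ i) (w₁ (finSucc i)))
    (h₂ : ∀ i, block (w₂ (finSucc i)) = finSucc (block (w₂ i)) ∨ E (w₂ i) (w₂ (finSucc i)))
    (hd : ∀ i j, w₁ i = w₂ j → w₁ (finSucc i) ≠ w₂ (finSucc j)) : GoodDecomp A := by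
  have hab := h.ab
  have hbc := h.bc
  have hca := h.ca
  have key : GoodOn A (π ⁻¹' Set.range ![a, b, c]) := by
    refine goodOn_preimage_range_of_walks
      (T := fun i j => i = a ∧ j = b ∨ i = b ∧ j = c ∨ i = c ∧ j = a) ?_ block
      (f := Sum.elim x (Sum.elim y z)) ?_ ![a, b, c] ?_ ?_ ?_ (by decide) E hE w₁ w₂ s₁ s₂ h₁ h₂ hd
    · rintro u v (⟨hu, hv⟩ | ⟨hu, hv⟩ | ⟨hu, hv⟩)
      exacts [h.arc_ab u v hu hv, h.arc_bc u v hu hv, h.arc_ca u v hu hv]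
    · refine hx.sumElim (hy.sumElim hz ?_) ?_
      · intro i j e
        exact hbc (by rw [← hyb i, ← hzc j, e])
      · rintro i (j | j) e
        · exact hab (by rw [← hxa i, ← hyb j]; exact congrArg π e)
        · exact hca (by rw [← hxa i, ← hzc j]; exact (congrArg π e).symm)
    · rintro (i | i | i)
      exacts [hxa i, hyb i, hzc i]
    · simp [Fin.forall_fin_succ, finSucc]
    · intro i
      fin_cases i
      · exact ⟨.inl ⟨0, by omega⟩, .inl ⟨1, by omega⟩, by simp, rfl, rfl⟩
      · exact ⟨.inr (.inl ⟨0, by omega⟩), .inr (.inl ⟨1, by omega⟩), by simp, rfl, rfl⟩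
      · exact ⟨.inr (.inr ⟨0, by omega⟩), .inr (.inr ⟨1, by omega⟩), by simp, rfl, rfl⟩
  refine key.goodDecomp fun v => ?_
  rcases h.cover (π v) with hv | hv | hv
  exacts [⟨0, hv.symm⟩, ⟨1, hv.symm⟩, ⟨2, hv.symm⟩]

theorem C3Comp.goodDecomp_of_four {V I : Type*} {A : V → V → Prop} {π : V → I} {a b c : I}
    (h : C3Comp A π a b c) {x : Fin 2 → V} {y : Fin 2 → V} {z : Fin 4 → V}
    (hx : x.Injective) (hy : y.Injective) (hz : z.Injective)
    (hxa : ∀ i, π (x i) = a) (hyb : ∀ i, π (y i) = b) (hzc : ∀ i, π (z i) = c)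
    : GoodDecomp A :=
  h.goodDecomp_of_walks hx hy hz hxa hyb hzc
    (by decide) (by decide) (by decide) (fun _ _ => False)
    (fun _ _ h => h.elim)
    ![.inl 0, .inr (.inl 1), .inr (.inr 2), .inl 0, .inr (.inl 1), .inr (.inr 3), .inl 1,
      .inr (.inl 0), .inr (.inr 1), .inl 1, .inr (.inl 0), .inr (.inr 0)]
    ![.inl 0, .inr (.inl 0), .inr (.inr 2), .inl 1, .inr (.inl 1), .inr (.inr 0), .inl 1,
      .inr (.inl 1), .inr (.inr 1), .inl 0, .inr (.inl 0), .inr (.inr 3)]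
    (by decide) (by decide) (by decide) (by decide) (by decide)

theorem C3Comp.goodDecomp_of_three_three {V I : Type*} {A : V → V → Prop} {π : V → I} {a b c : I}
    (h : C3Comp A π a b c) {x : Fin 2 → V} {y : Fin 3 → V} {z : Fin 3 → V}
    (hx : x.Injective) (hy : y.Injective) (hz : z.Injective)
    (hxa : ∀ i, π (x i) = a) (hyb : ∀ i, π (y i) = b) (hzc : ∀ i, π (z i) = c)
    : GoodDecomp A :=
  h.goodDecomp_of_walks hx hy hz hxa hyb hzc
    (by decide) (by decide) (by decide) (fun _ _ => False)
    (fun _ _ h => h.elim)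
    ![.inl 0, .inr (.inl 2), .inr (.inr 2), .inl 1, .inr (.inl 1), .inr (.inr 1), .inl 0,
      .inr (.inl 0), .inr (.inr 0)]
    ![.inl 0, .inr (.inl 1), .inr (.inr 0), .inl 1, .inr (.inl 2), .inr (.inr 1), .inl 1,
      .inr (.inl 0), .inr (.inr 2)]
    (by decide) (by decide) (by decide) (by decide) (by decide)

theorem C3Comp.goodDecomp_of_three_of_arc {V I : Type*} {A : V → V → Prop} {π : V → I} {a b c : I}
    (h : C3Comp A π a b c) {x : Fin 2 → V} {y : Fin 2 → V} {z : Fin 3 → V}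
    (hx : x.Injective) (hy : y.Injective) (hz : z.Injective)
    (hxa : ∀ i, π (x i) = a) (hyb : ∀ i, π (y i) = b) (hzc : ∀ i, π (z i) = c)
    (h0 : A (z 0) (z 1)) : GoodDecomp A :=
  h.goodDecomp_of_walks hx hy hz hxa hyb hzc
    (by decide) (by decide) (by decide) (fun p q => (p = .inr (.inr 0) ∧ q = .inr (.inr 1)))
    (by rintro _ _ ⟨rfl, rfl⟩; exact h0)
    ![.inl 0, .inr (.inl 1), .inr (.inr 0), .inr (.inr 1), .inl 1, .inr (.inl 0),
      .inr (.inr 2)]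
    ![.inl 0, .inr (.inl 0), .inr (.inr 0), .inl 1, .inr (.inl 1), .inr (.inr 2), .inl 1,
      .inr (.inl 1), .inr (.inr 1)]
    (by decide) (by decide) (by decide) (by decide) (by decide)

theorem C3Comp.goodDecomp_of_three_of_arc_succ {V I : Type*} {A : V → V → Prop} {π : V → I} {a b c : I}
    (h : C3Comp A π a b c) {x : Fin 2 → V} {y : Fin 2 → V} {z : Fin 3 → V}
    (hx : x.Injective) (hy : y.Injective) (hz : z.Injective)
    (hxa : ∀ i, π (x i) = a) (hyb : ∀ i, π (y i) = b) (hzc : ∀ i, π (z i) = c)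
    (h0 : A (x 0) (x 1)) : GoodDecomp A :=
  h.goodDecomp_of_walks hx hy hz hxa hyb hzc
    (by decide) (by decide) (by decide) (fun p q => (p = .inl 0 ∧ q = .inl 1))
    (by rintro _ _ ⟨rfl, rfl⟩; exact h0)
    ![.inl 0, .inr (.inl 0), .inr (.inr 1), .inl 1, .inr (.inl 1), .inr (.inr 2), .inl 1,
      .inr (.inl 1), .inr (.inr 0)]
    ![.inl 0, .inl 1, .inr (.inl 0), .inr (.inr 0), .inl 1, .inr (.inl 0), .inr (.inr 2),
      .inl 0, .inr (.inl 1), .inr (.inr 1)]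
    (by decide) (by decide) (by decide) (by decide) (by decide)

theorem C3Comp.goodDecomp_of_three_of_arc_pred {V I : Type*} {A : V → V → Prop} {π : V → I} {a b c : I}
    (h : C3Comp A π a b c) {x : Fin 2 → V} {y : Fin 2 → V} {z : Fin 3 → V}
    (hx : x.Injective) (hy : y.Injective) (hz : z.Injective)
    (hxa : ∀ i, π (x i) = a) (hyb : ∀ i, π (y i) = b) (hzc : ∀ i, π (z i) = c)
    (h0 : A (y 0) (y 1)) : GoodDecomp A :=
  h.goodDecomp_of_walks hx hy hz hxa hyb hzc
    (by decide) (by decide) (by decide) (fun p q => (p = .inr (.inl 0) ∧ q = .inr (.inl 1)))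
    (by rintro _ _ ⟨rfl, rfl⟩; exact h0)
    ![.inl 0, .inr (.inl 0), .inr (.inr 1), .inl 1, .inr (.inl 1), .inr (.inr 0), .inl 0,
      .inr (.inl 0), .inr (.inr 2)]
    ![.inl 0, .inr (.inl 1), .inr (.inr 2), .inl 1, .inr (.inl 0), .inr (.inr 0), .inl 1,
      .inr (.inl 0), .inr (.inl 1), .inr (.inr 1)]
    (by decide) (by decide) (by decide) (by decide) (by decide)

theorem C3Comp.goodDecomp_of_two_cycle {V I : Type*} {A : V → V → Prop} {π : V → I} {a b c : I}
    (h : C3Comp A π a b c) {x : Fin 2 → V} {y : Fin 2 → V} {z : Fin 2 → V}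
    (hx : x.Injective) (hy : y.Injective) (hz : z.Injective)
    (hxa : ∀ i, π (x i) = a) (hyb : ∀ i, π (y i) = b) (hzc : ∀ i, π (z i) = c)
    (h0 : A (x 0) (x 1)) (h1 : A (x 1) (x 0)) : GoodDecomp A :=
  h.goodDecomp_of_walks hx hy hz hxa hyb hzc
    (by decide) (by decide) (by decide) (fun p q => (p = .inl 0 ∧ q = .inl 1) ∨ (p = .inl 1 ∧ q = .inl 0))
    (by rintro _ _ (⟨rfl, rfl⟩ | ⟨rfl, rfl⟩); exacts [h0, h1])
    ![.inl 0, .inr (.inl 1), .inr (.inr 0), .inl 0, .inr (.inl 0), .inr (.inr 1), .inl 1]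
    ![.inl 0, .inl 1, .inr (.inl 0), .inr (.inr 0), .inl 1, .inr (.inl 1), .inr (.inr 1)]
    (by decide) (by decide) (by decide) (by decide) (by decide)

theorem C3Comp.goodDecomp_of_two_arcs {V I : Type*} {A : V → V → Prop} {π : V → I} {a b c : I}
    (h : C3Comp A π a b c) {x : Fin 2 → V} {y : Fin 2 → V} {z : Fin 2 → V}
    (hx : x.Injective) (hy : y.Injective) (hz : z.Injective)
    (hxa : ∀ i, π (x i) = a) (hyb : ∀ i, π (y i) = b) (hzc : ∀ i, π (z i) = c)
    (h0 : A (x 0) (x 1)) (h1 : A (y 0) (y 1)) : GoodDecomp A :=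
  h.goodDecomp_of_walks hx hy hz hxa hyb hzc
    (by decide) (by decide) (by decide) (fun p q => (p = .inl 0 ∧ q = .inl 1) ∨ (p = .inr (.inl 0) ∧ q = .inr (.inl 1)))
    (by rintro _ _ (⟨rfl, rfl⟩ | ⟨rfl, rfl⟩); exacts [h0, h1])
    ![.inl 0, .inl 1, .inr (.inl 0), .inr (.inr 1), .inl 1, .inr (.inl 0), .inr (.inl 1),
      .inr (.inr 0)]
    ![.inl 0, .inr (.inl 0), .inr (.inr 0), .inl 1, .inr (.inl 1), .inr (.inr 1)]
    (by decide) (by decide) (by decide) (by decide) (by decide)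

theorem injective_vec_two {V : Type*} {u v : V} (h : u ≠ v) : (![u, v] : Fin 2 → V).Injective := by
  simp [Function.Injective, Fin.forall_fin_succ, h, h.symm]

theorem injective_vec_three {V : Type*} {u v w : V} (h : u ≠ v) (h' : w ≠ u) (h'' : w ≠ v) :
    (![u, v, w] : Fin 3 → V).Injective := by
  simp [Function.Injective, Fin.forall_fin_succ, h, h.symm, h', h'.symm, h'', h''.symm]

theorem injective_vec_four {V : Type*} {u v w x : V} (h : u ≠ v) (h' : w ≠ u) (h'' : w ≠ v)
    (hu : x ≠ u) (hv : x ≠ v) (hw : x ≠ w) : (![u, v, w, x] : Fin 4 → V).Injective := by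
  simp [Function.Injective, Fin.forall_fin_succ, h, h.symm, h', h'.symm, h'', h''.symm, hu,
    hu.symm, hv, hv.symm, hw, hw.symm]

theorem C3Comp.dIso_of_bijective {V I W : Type*} {A : V → V → Prop} {B : W → W → Prop}
    {π : V → I} {a b c : I} (h : C3Comp A π a b c) (β : W → Fin 3) (g : W → V)
    (hg : g.Bijective) (hβ : ∀ p, π (g p) = ![a, b, c] (β p))
    (hne : ∀ p q, β p ≠ β q → (B p q ↔ β q = finSucc (β p)))
    (heq : ∀ p q, β p = β q → (A (g p) (g q) ↔ B p q)) : DIso A B := by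
  have hab := h.ab
  have hbc := h.bc
  have hca := h.ca
  have key : ∀ p q, A (g p) (g q) ↔ B p q := by
    intro p q
    by_cases hpq : β p = β q
    · exact heq p q hpq
    rw [hne p q hpq]
    have hp := hβ p
    have hq := hβ q
    have := h.arc (g p) (g q)
    have := h.arc_ab (g p) (g q)
    have := h.arc_bc (g p) (g q)
    have := h.arc_ca (g p) (g q)
    generalize β p = i at *
    generalize β q = j at *
    fin_cases i <;> fin_cases j <;> simp [finSucc] at * <;> grind
  refine ⟨(Equiv.ofBijective g hg).symm, fun u v => ?_⟩
  obtain ⟨p, rfl⟩ := hg.2 u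
  obtain ⟨q, rfl⟩ := hg.2 v
  simpa using key p q

theorem C3Comp.bijective_vec {V I : Type*} {A : V → V → Prop} {π : V → I} {a b c : I}
    (h : C3Comp A π a b c) {x y z : Fin 2 → V}
    (hx : x.Injective) (hy : y.Injective) (hz : z.Injective)
    (hxa : ∀ i, π (x i) = a) (hyb : ∀ i, π (y i) = b) (hzc : ∀ i, π (z i) = c)
    (sx : ∀ v, π v = a → ∃ i, x i = v) (sy : ∀ v, π v = b → ∃ i, y i = v)
    (sz : ∀ v, π v = c → ∃ i, z i = v) :
    (fun p : Fin 3 × Fin 2 => ![x, y, z] p.1 p.2).Bijective ∧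
      ∀ p : Fin 3 × Fin 2, π (![x, y, z] p.1 p.2) = ![a, b, c] p.1 := by
  have hπ : ∀ p : Fin 3 × Fin 2, π (![x, y, z] p.1 p.2) = ![a, b, c] p.1 := by
    rintro ⟨i, j⟩
    fin_cases i
    exacts [hxa j, hyb j, hzc j]
  refine ⟨⟨?_, ?_⟩, hπ⟩
  · rintro ⟨i, j⟩ ⟨i', j'⟩ e
    obtain rfl : i = i' := injective_vec_three h.ab h.ca h.bc.symm
      ((hπ (i, j)).symm.trans ((congrArg π e).trans (hπ (i', j'))))
    fin_cases i
    exacts [congrArg _ (hx e), congrArg _ (hy e), congrArg _ (hz e)]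
  · intro v
    rcases h.cover (π v) with hv | hv | hv
    · obtain ⟨i, rfl⟩ := sx v hv
      exact ⟨(0, i), rfl⟩
    · obtain ⟨i, rfl⟩ := sy v hv
      exact ⟨(1, i), rfl⟩
    · obtain ⟨i, rfl⟩ := sz v hv
      exact ⟨(2, i), rfl⟩

theorem exists_vec_two_eq {V I : Type*} {π : V → I} {i : I} {p q : V}
    (h : ∀ v, π v = i → v ≠ p → v = q) : ∀ v, π v = i → ∃ k, (![p, q] : Fin 2 → V) k = v := by
  intro v hv
  by_cases hvp : v = p
  · exact ⟨0, hvp.symm⟩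
  · exact ⟨1, (h v hv hvp).symm⟩

theorem C3Comp.dIso_exc1 {V I : Type*} {A : V → V → Prop} {π : V → I} {a b c : I}
    (h : C3Comp A π a b c) (h2 : ∀ i, ∃ p q, p ≠ q ∧ π p = i ∧ π q = i)
    (hA : ∀ u v, A u v → π u ≠ π v)
    (h3 : ∀ i p q r, p ≠ q → π p = i → π q = i → π r = i → r ≠ p → r = q) : DIso A Exc1 := by
  obtain ⟨x₀, x₁, hx, hx₀, hx₁⟩ := h2 a
  obtain ⟨y₀, y₁, hy, hy₀, hy₁⟩ := h2 b
  obtain ⟨z₀, z₁, hz, hz₀, hz₁⟩ := h2 c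
  obtain ⟨hg, hβ⟩ := h.bijective_vec (injective_vec_two hx) (injective_vec_two hy)
    (injective_vec_two hz) (by simp [Fin.forall_fin_succ, hx₀, hx₁])
    (by simp [Fin.forall_fin_succ, hy₀, hy₁]) (by simp [Fin.forall_fin_succ, hz₀, hz₁])
    (exists_vec_two_eq fun v hv => h3 a _ _ v hx hx₀ hx₁ hv)
    (exists_vec_two_eq fun v hv => h3 b _ _ v hy hy₀ hy₁ hv)
    (exists_vec_two_eq fun v hv => h3 c _ _ v hz hz₀ hz₁ hv)
  refine h.dIso_of_bijective Prod.fst _ hg hβ (fun p q _ => Iff.rfl) fun p q hpq => ?_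
  refine iff_of_false (fun hpq' => hA _ _ hpq' (by rw [hβ, hβ, hpq])) ?_
  simp only [Exc1, hpq]
  generalize q.1 = i
  revert i
  decide

theorem C3Comp.dIso_exc3 {V I : Type*} {A : V → V → Prop} {π : V → I} {a b c : I}
    (h : C3Comp A π a b c) (hA : ∀ u v, A u v → π u ≠ π v)
    {x y : Fin 2 → V} {z : Fin 3 → V}
    (hx : x.Injective) (hy : y.Injective) (hz : z.Injective)
    (hxa : ∀ i, π (x i) = a) (hyb : ∀ i, π (y i) = b) (hzc : ∀ i, π (z i) = c)
    (sx : ∀ v, π v = a → ∃ i, x i = v) (sy : ∀ v, π v = b → ∃ i, y i = v)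
    (sz : ∀ v, π v = c → ∃ i, z i = v) : DIso A Exc3 := by
  have hβ : ∀ p, π (Sum.elim x (Sum.elim y z) p) = ![a, b, c] (blk p) := by
    rintro (i | i | i)
    exacts [hxa i, hyb i, hzc i]
  refine h.dIso_of_bijective blk (Sum.elim x (Sum.elim y z)) ⟨?_, ?_⟩ hβ
    (fun p q _ => Iff.rfl) fun p q hpq => ?_
  · refine hx.sumElim (hy.sumElim hz ?_) ?_
    · intro i j e
      exact h.bc (by rw [← hyb i, ← hzc j, e])
    · rintro i (j | j) e
      · exact h.ab (by rw [← hxa i, ← hyb j]; exact congrArg π e)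
      · exact h.ca (by rw [← hxa i, ← hzc j]; exact (congrArg π e).symm)
  · intro v
    rcases h.cover (π v) with hv | hv | hv
    · obtain ⟨i, rfl⟩ := sx v hv
      exact ⟨.inl i, rfl⟩
    · obtain ⟨i, rfl⟩ := sy v hv
      exact ⟨.inr (.inl i), rfl⟩
    · obtain ⟨i, rfl⟩ := sz v hv
      exact ⟨.inr (.inr i), rfl⟩
  · refine iff_of_false (fun hpq' => hA _ _ hpq' (by rw [hβ, hβ, hpq])) ?_
    simp only [Exc3, hpq]
    generalize blk q = i
    revert i
    decide

/-- An arc within a block forces a good decomposition, unless the digraph is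
`C3[P2, K2bar, K2bar]`. -/
theorem C3Comp.goodDecomp_or_dIso_of_arc {V I : Type*} {A : V → V → Prop} {π : V → I} {a b c : I}
    (h : C3Comp A π a b c) (h2 : ∀ i, ∃ p q, p ≠ q ∧ π p = i ∧ π q = i) {u v : V}
    (huv : A u v) (hu : π u = a) (hv : π v = a) : GoodDecomp A ∨ DIso A Exc2 := by
  have huv' : u ≠ v := by
    rintro rfl
    exact h.irrefl u huv
  obtain ⟨y₀, y₁, hy, hy₀, hy₁⟩ := h2 b
  obtain ⟨z₀, z₁, hz, hz₀, hz₁⟩ := h2 c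
  have hx' := injective_vec_two huv'
  have hy' := injective_vec_two hy
  have hz' := injective_vec_two hz
  have hxa : ∀ i, π (![u, v] i) = a := by simp [Fin.forall_fin_succ, hu, hv]
  have hyb : ∀ i, π (![y₀, y₁] i) = b := by simp [Fin.forall_fin_succ, hy₀, hy₁]
  have hzc : ∀ i, π (![z₀, z₁] i) = c := by simp [Fin.forall_fin_succ, hz₀, hz₁]
  by_cases ha : ∃ w, π w = a ∧ w ≠ u ∧ w ≠ v
  · obtain ⟨w, hw, hwu, hwv⟩ := ha
    refine Or.inl (h.rotate.goodDecomp_of_three_of_arc hy' hz' (injective_vec_three huv' hwu hwv)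
      hyb hzc ?_ huv)
    simp [Fin.forall_fin_succ, hu, hv, hw]
  by_cases hb : ∃ w, π w = b ∧ w ≠ y₀ ∧ w ≠ y₁
  · obtain ⟨w, hw, hwu, hwv⟩ := hb
    refine Or.inl (h.rotate.rotate.goodDecomp_of_three_of_arc_pred hz' hx'
      (injective_vec_three hy hwu hwv) hzc hxa ?_ huv)
    simp [Fin.forall_fin_succ, hy₀, hy₁, hw]
  by_cases hc : ∃ w, π w = c ∧ w ≠ z₀ ∧ w ≠ z₁
  · obtain ⟨w, hw, hwu, hwv⟩ := hc
    refine Or.inl (h.goodDecomp_of_three_of_arc_succ hx' hy'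
      (injective_vec_three hz hwu hwv) hxa hyb ?_ huv)
    simp [Fin.forall_fin_succ, hz₀, hz₁, hw]
  push Not at ha hb hc
  by_cases hvu : A v u
  · exact Or.inl (h.goodDecomp_of_two_cycle hx' hy' hz' hxa hyb hzc huv hvu)
  by_cases hby : A y₀ y₁
  · exact Or.inl (h.goodDecomp_of_two_arcs hx' hy' hz' hxa hyb hzc huv hby)
  by_cases hby' : A y₁ y₀
  · refine Or.inl (h.goodDecomp_of_two_arcs hx' (injective_vec_two hy.symm) hz' hxa ?_ hzc huv hby')
    simp [Fin.forall_fin_succ, hy₀, hy₁]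
  by_cases hcz : A z₀ z₁
  · exact Or.inl (h.rotate.rotate.goodDecomp_of_two_arcs hz' hx' hy' hzc hxa hyb hcz huv)
  by_cases hcz' : A z₁ z₀
  · refine Or.inl (h.rotate.rotate.goodDecomp_of_two_arcs (injective_vec_two hz.symm) hx' hy' ?_
      hxa hyb hcz' huv)
    simp [Fin.forall_fin_succ, hz₀, hz₁]
  right
  obtain ⟨hg, hβ⟩ := h.bijective_vec hx' hy' hz' hxa hyb hzc (exists_vec_two_eq ha)
    (exists_vec_two_eq hb) (exists_vec_two_eq hc)
  refine h.dIso_of_bijective Prod.fst _ hg hβ ?_ ?_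
  · rintro ⟨i, k⟩ ⟨j, l⟩ hij
    simp only [Exc2, or_iff_left_iff_imp]
    rintro ⟨rfl, rfl, -⟩
    exact absurd rfl hij
  · rintro ⟨i, k⟩ ⟨j, l⟩ hij
    obtain rfl : i = j := hij
    fin_cases i <;> fin_cases k <;> fin_cases l <;>
      simp [Exc2, finSucc, h.irrefl, huv, hvu, hby, hby', hcz, hcz']

/-- If no arc joins two vertices of one block, a block with three vertices forces a good
decomposition, unless the digraph is `C3[K2bar, K2bar, K3bar]`. -/
theorem C3Comp.goodDecomp_or_dIso_of_three {V I : Type*} {A : V → V → Prop} {π : V → I}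
    {a b c : I} (h : C3Comp A π a b c) (h2 : ∀ i, ∃ p q, p ≠ q ∧ π p = i ∧ π q = i)
    (hA : ∀ u v, A u v → π u ≠ π v) {p q r : V} (hpq : p ≠ q) (hp : π p = c) (hq : π q = c)
    (hr : π r = c) (hrp : r ≠ p) (hrq : r ≠ q) : GoodDecomp A ∨ DIso A Exc3 := by
  obtain ⟨x₀, x₁, hx, hx₀, hx₁⟩ := h2 a
  obtain ⟨y₀, y₁, hy, hy₀, hy₁⟩ := h2 b
  have hx' := injective_vec_two hx
  have hy' := injective_vec_two hy
  have hz' := injective_vec_three hpq hrp hrq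
  have hxa : ∀ i, π (![x₀, x₁] i) = a := by simp [Fin.forall_fin_succ, hx₀, hx₁]
  have hyb : ∀ i, π (![y₀, y₁] i) = b := by simp [Fin.forall_fin_succ, hy₀, hy₁]
  have hzc : ∀ i, π (![p, q, r] i) = c := by simp [Fin.forall_fin_succ, hp, hq, hr]
  by_cases hc : ∃ v, π v = c ∧ v ≠ p ∧ v ≠ q ∧ v ≠ r
  · obtain ⟨v, hv, hvp, hvq, hvr⟩ := hc
    refine Or.inl (h.goodDecomp_of_four hx' hy' (injective_vec_four hpq hrp hrq hvp hvq hvr)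
      hxa hyb ?_)
    simp [Fin.forall_fin_succ, hp, hq, hr, hv]
  by_cases hb : ∃ v, π v = b ∧ v ≠ y₀ ∧ v ≠ y₁
  · obtain ⟨v, hv, hv₀, hv₁⟩ := hb
    refine Or.inl (h.goodDecomp_of_three_three hx' (injective_vec_three hy hv₀ hv₁) hz' hxa ?_ hzc)
    simp [Fin.forall_fin_succ, hy₀, hy₁, hv]
  by_cases ha : ∃ v, π v = a ∧ v ≠ x₀ ∧ v ≠ x₁
  · obtain ⟨v, hv, hv₀, hv₁⟩ := ha
    refine Or.inl (h.rotate.goodDecomp_of_three_three hy' hz' (injective_vec_three hx hv₀ hv₁)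
      hyb hzc ?_)
    simp [Fin.forall_fin_succ, hx₀, hx₁, hv]
  push Not at ha hb hc
  refine Or.inr (h.dIso_exc3 hA hx' hy' hz' hxa hyb hzc (exists_vec_two_eq ha)
    (exists_vec_two_eq hb) fun v hv => ?_)
  by_cases hvp : v = p
  · exact ⟨0, hvp.symm⟩
  by_cases hvq : v = q
  · exact ⟨1, hvq.symm⟩
  · exact ⟨2, (hc v hv hvp hvq).symm⟩

theorem C3Comp.classification {V I : Type*} {A : V → V → Prop} {π : V → I} {a b c : I}
    (h : C3Comp A π a b c) (h2 : ∀ i, ∃ p q, p ≠ q ∧ π p = i ∧ π q = i) :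
    GoodDecomp A ∨ DIso A Exc1 ∨ DIso A Exc2 ∨ DIso A Exc3 := by
  by_cases hA : ∃ u v, A u v ∧ π u = π v
  · obtain ⟨u, v, huv, hπ⟩ := hA
    have key : GoodDecomp A ∨ DIso A Exc2 := by
      rcases h.cover (π v) with hv | hv | hv
      · exact h.goodDecomp_or_dIso_of_arc h2 huv (hπ.trans hv) hv
      · exact h.rotate.goodDecomp_or_dIso_of_arc h2 huv (hπ.trans hv) hv
      · exact h.rotate.rotate.goodDecomp_or_dIso_of_arc h2 huv (hπ.trans hv) hv
    tauto
  push Not at hA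
  by_cases h3 : ∃ i p q r, p ≠ q ∧ π p = i ∧ π q = i ∧ π r = i ∧ r ≠ p ∧ r ≠ q
  · obtain ⟨i, p, q, r, hpq, hp, hq, hr, hrp, hrq⟩ := h3
    have key : GoodDecomp A ∨ DIso A Exc3 := by
      rcases h.cover i with rfl | rfl | rfl
      · exact h.rotate.goodDecomp_or_dIso_of_three h2 hA hpq hp hq hr hrp hrq
      · exact h.rotate.rotate.goodDecomp_or_dIso_of_three h2 hA hpq hp hq hr hrp hrq
      · exact h.goodDecomp_or_dIso_of_three h2 hA hpq hp hq hr hrp hrq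
    tauto
  · push Not at h3
    exact Or.inr (Or.inl (h.dIso_exc1 h2 hA h3))

theorem DIso.goodDecomp {V W : Type*} {A : V → V → Prop} {B : W → W → Prop} (h : DIso A B)
    (hA : GoodDecomp A) : GoodDecomp B := by
  obtain ⟨e, he⟩ := h
  obtain ⟨A₁, A₂, h₁, h₂, hd, s₁, s₂⟩ := hA
  have strong : ∀ C : V → V → Prop, IsStrong C → IsStrong fun x y => C (e.symm x) (e.symm y) := by
    intro C hC x y
    simpa [Function.onFun] using Relation.ReflTransGen.lift (p := fun x y => C (e.symm x) (e.symm y)) e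
      (fun u v huv => by simpa [Function.onFun] using huv) _ _ (hC (e.symm x) (e.symm y))
  refine ⟨fun x y => A₁ (e.symm x) (e.symm y), fun x y => A₂ (e.symm x) (e.symm y), ?_, ?_,
    fun x y => hd _ _, strong _ s₁, strong _ s₂⟩
  · intro x y hxy
    simpa using (he _ _).1 (h₁ _ _ hxy)
  · intro x y hxy
    simpa using (he _ _).1 (h₂ _ _ hxy)

/-- A good decomposition can be recorded by a 2-colouring of the arcs. -/
theorem GoodDecomp.exists_coloring {V : Type*} {A : V → V → Prop} (h : GoodDecomp A) :
    ∃ f : V → V → Bool, ∀ b, IsStrong fun x y => A x y ∧ f x y = b := by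
  classical
  obtain ⟨A₁, A₂, h₁, h₂, hd, s₁, s₂⟩ := h
  refine ⟨fun x y => decide (A₁ x y), Bool.forall_bool.2 ⟨fun x y => ?_, fun x y => ?_⟩⟩
  · refine Relation.ReflTransGen.mono (fun u v huv => ⟨h₂ u v huv, ?_⟩) _ _ (s₂ x y)
    simpa using fun h => hd u v ⟨h, huv⟩
  · refine Relation.ReflTransGen.mono (fun u v huv => ⟨h₁ u v huv, ?_⟩) _ _ (s₁ x y)
    simpa using huv

theorem fin_two_eq_one_sub : ∀ i j : Fin 2, i ≠ j → i = 1 - j := by decide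

theorem not_goodDecomp_exc3 : ¬ GoodDecomp Exc3 := by
  intro h
  obtain ⟨f, hf⟩ := h.exists_coloring
  have out : ∀ b u, ∃ v, Exc3 u v ∧ f u v = b := by
    intro b u
    obtain ⟨u', v, rfl, -, hv⟩ := (hf b).exists_arc_leaving (· = u) ⟨u, rfl⟩
      (by revert u; decide)
    exact ⟨v, hv⟩
  have inn : ∀ b v, ∃ u, Exc3 u v ∧ f u v = b := by
    intro b v
    obtain ⟨u, v', -, hv', hu⟩ := (hf b).exists_arc_leaving (· ≠ v)
      (by revert v; decide) ⟨v, by simp⟩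
    obtain rfl : v' = v := not_not.1 hv'
    exact ⟨u, hu⟩
  have path : ∀ b (i j : Fin 2), f (.inl i) (.inr (.inl (1 - j))) = b ∨
      ∃ k, f (.inr (.inl j)) (.inr (.inr k)) = b ∧ f (.inr (.inr k)) (.inl (1 - i)) = b := by
    intro b i j
    obtain ⟨u, v, hu, hv, huv, hb⟩ := (hf b).exists_arc_leaving
      (fun v => v = .inl i ∨ v = .inr (.inl j) ∨
        ∃ k, v = .inr (.inr k) ∧ f (.inr (.inl j)) v = b) ⟨_, Or.inl rfl⟩
      ⟨.inl (1 - i), by revert i; simp [Fin.forall_fin_succ]⟩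
    rcases hu with rfl | rfl | ⟨k, rfl, hk⟩
    · rcases v with v | v | v <;> simp_all [Exc3, blk, finSucc]
      left
      rwa [← fin_two_eq_one_sub v j hv]
    · rcases v with v | v | v <;> simp_all [Exc3, blk, finSucc]
    · rcases v with v | v | v <;> simp_all [Exc3, blk, finSucc]
      right
      refine ⟨k, hk, ?_⟩
      rwa [← fin_two_eq_one_sub v i hv]
  simp [Exc3, blk, finSucc, Fin.forall_fin_succ, Fin.exists_fin_succ] at out inn path
  grind

theorem not_goodDecomp_exc2 : ¬ GoodDecomp Exc2 := by
  intro h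
  obtain ⟨f, hf⟩ := h.exists_coloring
  have out : ∀ b u, ∃ v, Exc2 u v ∧ f u v = b := by
    intro b u
    obtain ⟨u', v, rfl, -, hv⟩ := (hf b).exists_arc_leaving (· = u) ⟨u, rfl⟩
      ⟨(u.1 + 1, u.2), by revert u; decide⟩
    exact ⟨v, hv⟩
  have inn : ∀ b v, ∃ u, Exc2 u v ∧ f u v = b := by
    intro b v
    obtain ⟨u, v', -, hv', hu⟩ := (hf b).exists_arc_leaving (· ≠ v)
      ⟨(v.1 + 1, v.2), by revert v; decide⟩ ⟨v, by simp⟩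
    obtain rfl : v' = v := not_not.1 hv'
    exact ⟨u, hu⟩
  have path : ∀ b (i j : Fin 2), f (0, i) (1, 1 - j) = b ∨
      (i = 0 ∧ f (0, 0) (0, 1) = b) ∨
      ∃ k, f (1, j) (2, k) = b ∧ f (2, k) (0, 1 - i) = b := by
    intro b i j
    obtain ⟨u, v, hu, hv, huv, hb⟩ := (hf b).exists_arc_leaving
      (fun v => v = (0, i) ∨ v = (1, j) ∨ ∃ k, v = (2, k) ∧ f (1, j) v = b) ⟨_, Or.inl rfl⟩
      ⟨(0, 1 - i), by revert i; simp [Fin.forall_fin_succ]⟩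
    obtain ⟨v, l⟩ := v
    rcases hu with rfl | rfl | ⟨k, rfl, hk⟩
    · fin_cases v <;> simp_all [Exc2, finSucc]
      left
      rwa [← fin_two_eq_one_sub l j hv]
    · fin_cases v <;> simp_all [Exc2, finSucc]
    · obtain rfl : v = 0 := by simpa [Exc2, finSucc] using huv
      have hl : l = 1 - i := fin_two_eq_one_sub l i (by rintro rfl; exact hv (Or.inl rfl))
      exact Or.inr (Or.inr ⟨k, hk, hl ▸ hb⟩)
  simp [Exc2, finSucc, Fin.forall_fin_succ, Fin.exists_fin_succ] at out inn path
  grind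

theorem not_goodDecomp_exc1 : ¬ GoodDecomp Exc1 := by
  rintro ⟨A₁, A₂, h₁, h₂, h⟩
  exact not_goodDecomp_exc2
    ⟨A₁, A₂, fun x y hxy => Or.inl (h₁ x y hxy), fun x y hxy => Or.inl (h₂ x y hxy), h⟩

theorem exists_three_cycle {I : Type*} [Nontrivial I] {T : I → I → Prop} (hTs : IsStrong T)
    (hTsc : Semicomplete T) (h2 : ∀ i j, T i j → ¬ T j i) : ∃ a b c, T a b ∧ T b c ∧ T c a := by
  obtain ⟨a, d, had⟩ := exists_pair_ne I
  obtain ⟨x, b, hx, -, hxb⟩ := hTs.exists_arc_leaving (· = a) ⟨a, rfl⟩ ⟨d, had.symm⟩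
  have hab : T a b := hx ▸ hxb
  obtain ⟨u, w, hu, hw, huw⟩ := hTs.exists_arc_leaving (T a) ⟨b, hab⟩
    ⟨a, fun h => h2 _ _ h h⟩
  refine ⟨a, u, w, hu, huw, (hTsc a w ?_).resolve_left hw⟩
  rintro rfl
  exact h2 _ _ hu huw

theorem exists_four_cycle {I : Type*} {T : I → I → Prop} (hTs : IsStrong T)
    (hTsc : Semicomplete T) (h2 : ∀ i j, T i j → ¬ T j i) {a b c : I} (hab : T a b) (hbc : T b c)
    (hca : T c a) {v : I} (hva : v ≠ a) (hvb : v ≠ b) (hvc : v ≠ c) :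
    ∃ a b c d, [a, b, c, d].Nodup ∧ T a b ∧ T b c ∧ T c d ∧ T d a := by
  have nodup : ∀ a b c d, T a b → T b c → T c d → T d a → [a, b, c, d].Nodup := by
    intro a b c d h₁ h₃ h₄ h₅
    simp only [List.nodup_cons, List.mem_cons, List.not_mem_nil, or_false, List.nodup_nil]
    grind
  by_contra! hno
  have no : ∀ a b c d, T a b → T b c → T c d → ¬ T d a := fun a b c d h₁ h₃ h₄ h₅ =>
    hno a b c d (nodup a b c d h₁ h₃ h₄ h₅) h₁ h₃ h₄ h₅
  obtain ⟨x, u, hx, hu, hxu⟩ := hTs.exists_arc_leaving (fun i => i = a ∨ i = b ∨ i = c)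
    ⟨a, Or.inl rfl⟩ ⟨v, by simp [*]⟩
  have all : ∀ w, ¬ (w = a ∨ w = b ∨ w = c) → T a w ∨ T b w ∨ T c w → T a w ∧ T b w ∧ T c w := by
    intro w hw
    have := hTsc a w
    have := hTsc b w
    have := hTsc c w
    grind
  obtain ⟨u, w, ⟨hu, hau⟩, hw, huw⟩ := hTs.exists_arc_leaving
    (fun i => ¬ (i = a ∨ i = b ∨ i = c) ∧ T a i)
    ⟨u, hu, (all u hu (by rcases hx with rfl | rfl | rfl <;> simp [hxu])).1⟩ ⟨a, by simp⟩
  have hu' := all u hu (Or.inl hau)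
  have hw' : ¬ (w = a ∨ w = b ∨ w = c) := by
    rintro (rfl | rfl | rfl)
    exacts [h2 _ _ huw hu'.1, h2 _ _ huw hu'.2.1, h2 _ _ huw hu'.2.2]
  have hwa : T w a := (hTsc w a fun h => hw' (Or.inl h)).resolve_right fun h => hw ⟨hw', h⟩
  exact no a b u w hab hu'.2.1 huw hwa

theorem goodDecomp_or_dIso {V I : Type*} [Finite I] [Nontrivial I] {A : V → V → Prop}
    {T : I → I → Prop} {π : V → I} (hA : ∀ u v, T (π u) (π v) → A u v)
    (hA' : ∀ u v, A u v → π u ≠ π v → T (π u) (π v)) (hirr : ∀ u, ¬ A u u)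
    (h2 : ∀ i, ∃ p q, p ≠ q ∧ π p = i ∧ π q = i) (hTs : IsStrong T) (hTsc : Semicomplete T) :
    GoodDecomp A ∨ DIso A Exc1 ∨ DIso A Exc2 ∨ DIso A Exc3 := by
  have hT : ∀ i, ¬ T i i := by
    intro i hi
    obtain ⟨p, -, -, rfl, -⟩ := h2 i
    exact hirr p (hA p p hi)
  by_cases hc : ∃ a b, T a b ∧ T b a
  · obtain ⟨a, b, hab, hba⟩ := hc
    have hne : a ≠ b := by
      rintro rfl
      exact hT a hab
    exact Or.inl (goodDecomp_of_goodOn_preimage hA h2 hTs hTsc (Set.range_nonempty _)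
      (goodOn_of_two_cycle hA h2 hne hab hba))
  push Not at hc
  obtain ⟨a, b, c, hab, hbc, hca⟩ := exists_three_cycle hTs hTsc hc
  by_cases hv : ∃ v, v ≠ a ∧ v ≠ b ∧ v ≠ c
  · obtain ⟨v, hva, hvb, hvc⟩ := hv
    obtain ⟨a, b, c, d, hn, hab, hbc, hcd, hda⟩ :=
      exists_four_cycle hTs hTsc hc hab hbc hca hva hvb hvc
    exact Or.inl (goodDecomp_of_goodOn_preimage hA h2 hTs hTsc (Set.range_nonempty _)
      (goodOn_of_four_cycle hA h2 hn hab hbc hcd hda))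
  push Not at hv
  have cover : ∀ i, i = a ∨ i = b ∨ i = c := by
    intro i
    have := hv i
    tauto
  have hC : C3Comp A π a b c :=
    { ab := by rintro rfl; exact hT _ hab
      bc := by rintro rfl; exact hT _ hbc
      ca := by rintro rfl; exact hT _ hca
      cover := cover
      arc_ab := fun u v hu hv => hA u v (by rwa [hu, hv])
      arc_bc := fun u v hu hv => hA u v (by rwa [hu, hv])
      arc_ca := fun u v hu hv => hA u v (by rwa [hu, hv])
      arc := by
        intro u v huv hne
        have := hA' u v huv hne
        have := cover (π u)
        have := cover (π v)
        grind
      irrefl := hirr }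
  exact hC.classification h2

theorem stmt_8 {t : ℕ} (ht : 2 ≤ t) {Vt : Fin t → Type*} [∀ i, Fintype (Vt i)]
    (T : Fin t → Fin t → Prop) (hT : Irreflexive T) (hTs : IsStrong T)
    (hTsc : Semicomplete T)
    (H : ∀ i, Vt i → Vt i → Prop) (hH : ∀ i, Irreflexive (H i))
    (hcard : ∀ i, 2 ≤ Fintype.card (Vt i)) :
    GoodDecomp (CompArc T H) ↔
      ¬ (DIso (CompArc T H) Exc1 ∨ DIso (CompArc T H) Exc2 ∨
          DIso (CompArc T H) Exc3) := by
  constructor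
  · rintro h (hd | hd | hd)
    exacts [not_goodDecomp_exc1 (hd.goodDecomp h), not_goodDecomp_exc2 (hd.goodDecomp h),
      not_goodDecomp_exc3 (hd.goodDecomp h)]
  · intro h
    have : Nontrivial (Fin t) := Fin.nontrivial_iff_two_le.2 ht
    have key := goodDecomp_or_dIso (A := CompArc T H) (π := Sigma.fst) (fun u v => Or.inl)
      (fun u v huv hne => huv.resolve_right fun ⟨e, _⟩ => hne e) ?_ ?_ hTs hTsc
    · tauto
    · rintro ⟨i, u⟩ (hu | ⟨_, hu⟩)
      exacts [hT _ hu, hH i _ hu]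
    · intro i
      obtain ⟨p, q, hpq⟩ := Fintype.exists_pair_of_one_lt_card (hcard i)
      exact ⟨⟨i, p⟩, ⟨i, q⟩, by simpa using hpq, rfl, rfl⟩
end

section
/- Let G be a strong digraph on at least two vertices that has a collection of pairwise arc-disjoint directed cycles covering all its vertices. Then the Cartesian product digraph G □ G can be decomposed into two arc-disjoint strong spanning subdigraphs. -/
open Relation

/-- The arcs of `CartProd G G` inside `S × S` selected by `K`: the horizontal copy of `a → b` in
row `y` is kept iff `¬ K y a b`, the vertical copy of `a → b` in column `x` is kept iff `K x a b`.
Swapping the coordinates maps this digraph to an arc-disjoint one. -/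
def SelArc {V : Type*} (G : V → V → Prop) (K : V → V → V → Prop) (S : Set V) :
    V × V → V × V → Prop :=
  fun p q => (p.1 ∈ S ∧ p.2 ∈ S ∧ q.1 ∈ S ∧ q.2 ∈ S) ∧
    ((G p.1 q.1 ∧ p.2 = q.2 ∧ ¬ K p.2 p.1 q.1) ∨ (p.1 = q.1 ∧ G p.2 q.2 ∧ K p.1 p.2 q.2))

/-- Some selection makes `S × S` strong. -/
def SelStrong {V : Type*} (G : V → V → Prop) (S : Set V) : Prop :=
  ∃ K : V → V → V → Prop, ∀ x ∈ S, ∀ y ∈ S, ∀ x' ∈ S, ∀ y' ∈ S,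
    ReflTransGen (SelArc G K S) (x, y) (x', y')

/-- An ear of `S` with inner vertices `r 1, …, r m` (`m ≥ 1`). -/
structure IsEar {V : Type*} (G : V → V → Prop) (S : Set V) (m : ℕ) (r : ℕ → V) : Prop where
  one_le : 1 ≤ m
  first_mem : r 0 ∈ S
  last_mem : r (m + 1) ∈ S
  notMem : ∀ i, 1 ≤ i → i ≤ m → r i ∉ S
  arc : ∀ i, i ≤ m → G (r i) (r (i + 1))

/-- Extension of a selection along an ear. -/
def earSel {V : Type*} (K : V → V → V → Prop) (S : Set V) (m : ℕ) (r : ℕ → V) :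
    V → V → V → Prop :=
  fun x a b => (x ∈ S ∧ a ∈ S ∧ b ∈ S ∧ K x a b) ∨
    ∃ i ≤ m, x = r i ∧ a = r (m - i) ∧ b = r (m - i + 1)

theorem exists_path_to_set {V : Type*} {G : V → V → Prop} {S : Set V} {w s : V} (hs : s ∈ S)
    (h : ReflTransGen G w s) (hw : w ∉ S) :
    ∃ (m : ℕ) (r : ℕ → V), r 0 = w ∧ r (m + 1) ∈ S ∧ (∀ i ≤ m, r i ∉ S) ∧
      ∀ i ≤ m, G (r i) (r (i + 1)) := by
  induction h using ReflTransGen.head_induction_on with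
  | refl => exact absurd hs hw
  | @head w w' hww' _ ih =>
    by_cases hw' : w' ∈ S
    · refine ⟨0, fun i => if i = 0 then w else w', by simp, by simpa, ?_, ?_⟩
      · intro i hi
        obtain rfl : i = 0 := by omega
        simpa
      · intro i hi
        obtain rfl : i = 0 := by omega
        simpa
    · obtain ⟨m, r, h0, hm, hn, ha⟩ := ih hw'
      refine ⟨m + 1, fun i => Nat.casesOn i w r, rfl, hm, ?_, ?_⟩
      · rintro (_ | i) hi
        · exact hw
        · exact hn i (by omega)
      · rintro (_ | i) hi
        · simpa [h0] using hww'
        · exact ha i (by omega)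

theorem exists_arc_out {V : Type*} {G : V → V → Prop} {S : Set V} {s w : V} (hs : s ∈ S)
    (h : ReflTransGen G s w) (hw : w ∉ S) : ∃ a ∈ S, ∃ b ∉ S, G a b := by
  induction h with
  | refl => exact absurd hs hw
  | @tail b c _ hbc ih =>
    by_cases hb : b ∈ S
    · exact ⟨b, hb, c, hw, hbc⟩
    · exact ih hb

theorem exists_isEar {V : Type*} {G : V → V → Prop} (hG : IsStrong G) {S : Set V}
    (hS : S.Nonempty) (hS' : S ≠ Set.univ) : ∃ m r, IsEar G S m r := by
  obtain ⟨s, hs⟩ := hS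
  obtain ⟨w, hw⟩ := (Set.ne_univ_iff_exists_notMem S).1 hS'
  obtain ⟨a, ha, b, hb, hab⟩ := exists_arc_out hs (hG s w) hw
  obtain ⟨m, r, h0, hm, hn, har⟩ := exists_path_to_set hs (hG b s) hb
  refine ⟨m + 1, fun i => Nat.casesOn i a r, by omega, ha, hm, ?_, ?_⟩
  · rintro (_ | i) hi hi'
    · omega
    · exact hn i (by omega)
  · rintro (_ | i) hi
    · simpa [h0] using hab
    · exact har i (by omega)

theorem exists_isEar_injOn {V : Type*} {G : V → V → Prop} {S : Set V}
    (h : ∃ m r, IsEar G S m r) :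
    ∃ m r, IsEar G S m r ∧ ∀ i j, 1 ≤ i → i < j → j ≤ m → r i ≠ r j := by
  classical
  obtain ⟨r, hr⟩ := Nat.find_spec h
  refine ⟨Nat.find h, r, hr, fun i j hi hij hj hrij => ?_⟩
  set m := Nat.find h with hm
  refine Nat.find_min h (m := m - (j - i)) (by omega)
    ⟨fun k => if k ≤ i then r k else r (k + (j - i)), by omega, ?_, ?_, ?_, ?_⟩
  · simpa using hr.first_mem
  · have : ¬ m - (j - i) + 1 ≤ i := by omega
    rw [if_neg this]
    convert hr.last_mem using 2
    omega
  · intro k hk hk'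
    split_ifs with hki
    · exact hr.notMem k hk (by omega)
    · exact hr.notMem _ (by omega) (by omega)
  · intro k hk
    rcases lt_trichotomy k i with hki | rfl | hki
    · rw [if_pos hki.le, if_pos (by omega)]
      exact hr.arc k (by omega)
    · rw [if_pos le_rfl, if_neg (by omega), hrij]
      convert hr.arc j hj using 2
      omega
    · rw [if_neg (by omega), if_neg (by omega)]
      convert hr.arc (k + (j - i)) (by omega) using 2
      omega

/-- Projecting a strong selection on `S × S` to the first coordinate. -/
theorem reflTransGen_induced {V : Type*} {G : V → V → Prop} {K : V → V → V → Prop} {S : Set V}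
    {p q : V × V} (h : ReflTransGen (SelArc G K S) p q) :
    ReflTransGen (fun a b => a ∈ S ∧ b ∈ S ∧ G a b) p.1 q.1 := by
  refine ReflTransGen.lift' Prod.fst ?_ _ _ h
  rintro a b ⟨⟨h1, -, h2, -⟩, ⟨h, -⟩ | ⟨h, -⟩⟩
  · exact .single ⟨h1, h2, h⟩
  · rw [Function.onFun, h]

namespace IsEar

variable {V : Type*} {G : V → V → Prop} {K : V → V → V → Prop} {S : Set V} {m : ℕ} {r : ℕ → V}

theorem not_both_mem (hr : IsEar G S m r) {j : ℕ} (hj : j ≤ m) (h : r j ∈ S) : r (j + 1) ∉ S := by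
  have := hr.one_le
  rcases Nat.eq_zero_or_pos j with rfl | h0
  · exact hr.notMem 1 le_rfl this
  · exact absurd h (hr.notMem j h0 hj)

theorem eq_of_eq (hr : IsEar G S m r) (hinj : ∀ i j, 1 ≤ i → i < j → j ≤ m → r i ≠ r j)
    {i j : ℕ} (hi : i ≤ m) (hj : j ≤ m) (h : r i = r j) : i = j := by
  have h0 := hr.first_mem
  rcases Nat.eq_zero_or_pos i with rfl | hi0
  · by_contra hne
    exact hr.notMem j (by omega) hj (h ▸ h0)
  rcases Nat.eq_zero_or_pos j with rfl | hj0
  · exact absurd (h ▸ h0) (hr.notMem i hi0 hi)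
  rcases lt_trichotomy i j with hij | hij | hij
  · exact absurd h (hinj i j hi0 hij hj)
  · exact hij
  · exact absurd h.symm (hinj j i hj0 hij hi)

theorem earSel_of_mem (hr : IsEar G S m r) {x a b : V} (ha : a ∈ S) (hb : b ∈ S) :
    earSel K S m r x a b ↔ x ∈ S ∧ K x a b := by
  constructor
  · rintro (⟨hx, -, -, h⟩ | ⟨i, hi, -, rfl, rfl⟩)
    · exact ⟨hx, h⟩
    · exact absurd hb (hr.not_both_mem (by omega) ha)
  · rintro ⟨hx, h⟩
    exact .inl ⟨hx, ha, hb, h⟩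

theorem earSel_arc (hr : IsEar G S m r) (hinj : ∀ i j, 1 ≤ i → i < j → j ≤ m → r i ≠ r j)
    {x : V} {j : ℕ} (hj : j ≤ m) :
    earSel K S m r x (r j) (r (j + 1)) ↔ x = r (m - j) := by
  constructor
  · rintro (⟨-, ha, hb, -⟩ | ⟨i, hi, rfl, h, -⟩)
    · exact absurd hb (hr.not_both_mem hj ha)
    · have := hr.eq_of_eq hinj hj (by omega) h
      congr 1
      omega
  · rintro rfl
    have : m - (m - j) = j := by omega
    exact .inr ⟨m - j, by omega, rfl, by rw [this], by rw [this]⟩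

theorem selStrong_union (hr : IsEar G S m r)
    (hinj : ∀ i j, 1 ≤ i → i < j → j ≤ m → r i ≠ r j) (hS : SelStrong G S) :
    SelStrong G (S ∪ r '' Set.Icc 1 m) := by
  obtain ⟨K, hK⟩ := hS
  set S' := S ∪ r '' Set.Icc 1 m with hS'
  set T := SelArc G (earSel K S m r) S' with hT
  have hsub : ∀ {x}, x ∈ S → x ∈ S' := fun h => .inl h
  have hmem : ∀ j ≤ m + 1, r j ∈ S' := by
    intro j hj
    rcases Nat.eq_zero_or_pos j with rfl | h0
    · exact hsub hr.first_mem
    rcases Nat.lt_or_ge m j with h1 | h1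
    · obtain rfl : j = m + 1 := by omega
      exact hsub hr.last_mem
    · exact .inr ⟨j, ⟨h0, h1⟩, rfl⟩
  have hcases : ∀ x ∈ S', x ∈ S ∨ ∃ j ≤ m, 1 ≤ j ∧ x = r j := by
    rintro x (h | ⟨j, ⟨h1, h2⟩, rfl⟩)
    · exact .inl h
    · exact .inr ⟨j, h2, h1, rfl⟩
  have hSS : ∀ x ∈ S, ∀ y ∈ S, ∀ x' ∈ S, ∀ y' ∈ S, ReflTransGen T (x, y) (x', y') := by
    intro x hx y hy x' hx' y' hy'
    refine ReflTransGen.mono ?_ _ _ (hK x hx y hy x' hx' y' hy')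
    rintro ⟨a, b⟩ ⟨c, d⟩ ⟨⟨ha, hb, hc, hd⟩, h⟩
    refine ⟨⟨hsub ha, hsub hb, hsub hc, hsub hd⟩, ?_⟩
    simp only at ha hb hc hd h ⊢
    rw [hr.earSel_of_mem ha hc, hr.earSel_of_mem hb hd]
    tauto
  have hind : ∀ y ∈ S', y ∉ S → ∀ a ∈ S, ∀ b ∈ S, ReflTransGen T (a, y) (b, y) := by
    intro y hy hyS a ha b hb
    refine ReflTransGen.lift (fun a => (a, y)) ?_ _ _ (reflTransGen_induced (hK a ha a ha b hb a ha))
    rintro c d ⟨hc, hd, hcd⟩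
    refine ⟨⟨hsub hc, hy, hsub hd, hy⟩, .inl ⟨hcd, rfl, ?_⟩⟩
    rw [hr.earSel_of_mem hc hd]
    tauto
  have hseg : ∀ y ∈ S', ∀ i j, i ≤ j → j ≤ m + 1 →
      (∀ k, i ≤ k → k < j → y ≠ r (m - k)) → ReflTransGen T (r i, y) (r j, y) := by
    intro y hy i j hij
    induction j, hij using Nat.le_induction with
    | base => exact fun _ _ => .refl
    | succ j hij ih =>
      intro hj hne
      refine (ih (by omega) fun k h1 h2 => hne k h1 (by omega)).tail
        ⟨⟨hmem _ (by omega), hy, hmem _ hj, hy⟩, .inl ⟨hr.arc j (by omega), rfl, ?_⟩⟩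
      rw [hr.earSel_arc hinj (by omega)]
      exact hne j hij (by omega)
  have hne : ∀ i ≤ m, ∀ k ≤ m, k ≠ m - i → r i ≠ r (m - k) := by
    intro i hi k hk hki h
    have := hr.eq_of_eq hinj hi (by omega) h
    omega
  have hvert : ∀ i ≤ m, ReflTransGen T (r (m - i), r i) (r (m - i), r (i + 1)) := by
    intro i hi
    refine .single ⟨⟨hmem _ (by omega), hmem _ (by omega), hmem _ (by omega), hmem _ (by omega)⟩,
      .inr ⟨rfl, hr.arc i hi, ?_⟩⟩
    rw [hr.earSel_arc hinj hi]
  have hrow : ∀ i ≤ m, ∀ a ∈ S, ∀ b ∈ S, ReflTransGen T (a, r i) (b, r i) := by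
    intro i hi a ha b hb
    rcases Nat.eq_zero_or_pos i with rfl | h0
    · exact hSS _ ha _ hr.first_mem _ hb _ hr.first_mem
    · exact hind _ (hmem i (by omega)) (hr.notMem i h0 hi) a ha b hb
  have hentry : ∀ i ≤ m, ReflTransGen T (r (m - i + 1), r i) (r (m + 1), r i) := by
    intro i hi
    exact hseg _ (hmem i (by omega)) _ _ (by omega) le_rfl
      fun k h1 h2 => hne i hi k (by omega) (by omega)
  have hexit : ∀ i ≤ m, ReflTransGen T (r 0, r i) (r (m - i), r i) := by
    intro i hi
    exact hseg _ (hmem i (by omega)) _ _ (by omega) (by omega)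
      fun k h1 h2 => hne i hi k (by omega) (by omega)
  have hfrom : ∀ i ≤ m, ∀ x ∈ S', ReflTransGen T (r (m - i + 1), r i) (x, r i) := by
    intro i hi x hx
    rcases hcases x hx with hx | ⟨j, hj, h1, rfl⟩
    · exact (hentry i hi).trans (hrow i hi _ hr.last_mem _ hx)
    by_cases hji : j ≤ m - i
    · refine ((hentry i hi).trans (hrow i hi _ hr.last_mem _ hr.first_mem)).trans ?_
      exact hseg _ (hmem i (by omega)) _ _ (by omega) (by omega)
        fun k h1 h2 => hne i hi k (by omega) (by omega)
    · exact hseg _ (hmem i (by omega)) _ _ (by omega) (by omega)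
        fun k h1 h2 => hne i hi k (by omega) (by omega)
  have hto : ∀ i ≤ m, ∀ x ∈ S', ReflTransGen T (x, r i) (r (m - i), r i) := by
    intro i hi x hx
    rcases hcases x hx with hx | ⟨j, hj, h1, rfl⟩
    · exact (hrow i hi _ hx _ hr.first_mem).trans (hexit i hi)
    by_cases hji : j ≤ m - i
    · exact hseg _ (hmem i (by omega)) _ _ (by omega) (by omega)
        fun k h1 h2 => hne i hi k (by omega) (by omega)
    · refine ReflTransGen.trans ?_
        ((hrow i hi _ hr.last_mem _ hr.first_mem).trans (hexit i hi))
      exact hseg _ (hmem i (by omega)) _ _ (by omega) (by omega)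
        fun k h1 h2 => hne i hi k (by omega) (by omega)
  have hreach : ∀ i ≤ m, ReflTransGen T (r 0, r 0) (r (m - i + 1), r i) := by
    intro i
    induction i with
    | zero => exact fun _ => hSS _ hr.first_mem _ hr.first_mem _ hr.last_mem _ hr.first_mem
    | succ i ih =>
      intro hi
      have h1 := (ih (by omega)).trans (hfrom i (by omega) _ (hmem (m - i) (by omega)))
      have h2 : m - (i + 1) + 1 = m - i := by omega
      rw [h2]
      exact h1.trans (hvert i (by omega))
  have hback : ∀ i ≤ m, ReflTransGen T (r (m - i), r i) (r 0, r 0) := by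
    intro i hi
    induction hi using Nat.decreasingInduction with
    | self =>
      refine (hvert m le_rfl).trans ?_
      simp only [Nat.sub_self]
      exact hSS _ hr.first_mem _ hr.last_mem _ hr.first_mem _ hr.first_mem
    | of_succ i hi ih =>
      exact ((hvert i hi.le).trans (hto (i + 1) hi _ (hmem _ (by omega)))).trans ih
  have hall : ∀ x ∈ S', ∀ y ∈ S',
      ReflTransGen T (r 0, r 0) (x, y) ∧ ReflTransGen T (x, y) (r 0, r 0) := by
    intro x hx y hy
    by_cases hyr : ∃ i ≤ m, y = r i
    · obtain ⟨i, hi, rfl⟩ := hyr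
      exact ⟨(hreach i hi).trans (hfrom i hi x hx), (hto i hi x hx).trans (hback i hi)⟩
    · have hyS : y ∈ S := (hcases y hy).resolve_right fun ⟨j, hj, _, h⟩ => hyr ⟨j, hj, h⟩
      have hfull : ∀ k, y ≠ r (m - k) := fun k h => hyr ⟨m - k, by omega, h⟩
      rcases hcases x hx with hx | ⟨j, hj, -, rfl⟩
      · exact ⟨hSS _ hr.first_mem _ hr.first_mem _ hx _ hyS,
          hSS _ hx _ hyS _ hr.first_mem _ hr.first_mem⟩
      · exact ⟨(hSS _ hr.first_mem _ hr.first_mem _ hr.first_mem _ hyS).trans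
            (hseg y hy 0 j (by omega) (by omega) fun k _ _ => hfull k),
          (hseg y hy j (m + 1) (by omega) le_rfl fun k _ _ => hfull k).trans
            (hSS _ hr.last_mem _ hyS _ hr.first_mem _ hr.first_mem)⟩
  exact ⟨earSel K S m r, fun x hx y hy x' hx' y' hy' =>
    (hall x hx y hy).2.trans (hall x' hx' y' hy').1⟩

end IsEar

theorem selStrong_univ {V : Type*} [Finite V] [Nonempty V] {G : V → V → Prop}
    (hG : IsStrong G) : SelStrong G Set.univ := by
  obtain ⟨v⟩ := ‹Nonempty V›
  have hv : SelStrong G {v} := by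
    refine ⟨fun _ _ _ => False, ?_⟩
    rintro _ rfl _ rfl _ rfl _ rfl
    exact .refl
  obtain ⟨S, -, hS⟩ := (Set.toFinite {S : Set V | S.Nonempty ∧ SelStrong G S}).exists_le_maximal
    (a := {v}) ⟨Set.singleton_nonempty v, hv⟩
  by_contra hcon
  have hne : S ≠ Set.univ := fun h => hcon (h ▸ hS.prop.2)
  obtain ⟨m, r, hr, hinj⟩ := exists_isEar_injOn (exists_isEar hG hS.prop.1 hne)
  have hle := hS.le_of_ge ⟨hS.prop.1.inl, hr.selStrong_union hinj hS.prop.2⟩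
    Set.subset_union_left
  exact hr.notMem 1 le_rfl hr.one_le (hle (.inr ⟨1, ⟨le_rfl, hr.one_le⟩, rfl⟩))

theorem goodDecomp_of_selStrong_univ {V : Type*} {G : V → V → Prop} (hG : ∀ x, ¬ G x x)
    (h : SelStrong G Set.univ) : GoodDecomp (CartProd G G) := by
  obtain ⟨K, hK⟩ := h
  have hK' : IsStrong (SelArc G K Set.univ) := fun p q =>
    hK p.1 trivial p.2 trivial q.1 trivial q.2 trivial
  refine ⟨SelArc G K Set.univ, fun p q => SelArc G K Set.univ p.swap q.swap, ?_, ?_, ?_, hK', ?_⟩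
  · rintro p q ⟨-, ⟨h1, h2, -⟩ | ⟨h1, h2, -⟩⟩
    · exact .inl ⟨h1, h2⟩
    · exact .inr ⟨h1, h2⟩
  · rintro p q ⟨-, ⟨h1, h2, -⟩ | ⟨h1, h2, -⟩⟩
    · exact .inr ⟨h2, h1⟩
    · exact .inl ⟨h2, h1⟩
  · rintro ⟨a, b⟩ ⟨c, d⟩ ⟨⟨-, h⟩, ⟨-, h'⟩⟩
    have ha := hG a
    have hb := hG b
    simp only [Prod.swap] at h h'
    rcases h with ⟨h1, h2, h3⟩ | ⟨h1, h2, h3⟩ <;> rcases h' with ⟨h4, h5, h6⟩ | ⟨h4, h5, h6⟩ <;>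
      subst_vars <;> contradiction
  · intro p q
    exact ReflTransGen.lift (r := SelArc G K Set.univ) Prod.swap (fun _ _ h => h) _ _ (hK' p.swap q.swap)

theorem stmt_10 {V : Type*} [Fintype V] [Nontrivial V]
    (G : V → V → Prop) (hG : Irreflexive G) (hGs : IsStrong G)
    (hcover : HasCycleCover G) :
    GoodDecomp (CartProd G G) := by
  exact goodDecomp_of_selStrong_univ hG (selStrong_univ hGs)
end
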